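/- Let κ satisfy the energy, consistency, and domination principles, and assume (A1) and (A2). Let A ⊂ X be arbitrary, let (U_j)_{j≥1} be an increasing sequence of Borel subsets of X with ⋃_j U_j = X, and set A_j := A ∩ U_j. Then there exist Borel sets B_j with B_j ⊂ A_j and B_j ⊂ B_{j+1} for each j, independent of μ, such that for every μ ∈ E⁺: the outer balayages μ^{*B_j} exist, ‖μ^{*B_j} − μ^A‖ → 0 as j → ∞, μ^{*B_j} → μ^A vaguely, and κμ^{*B_j}(x) → κμ^A(x) for quasi-every x ∈ X. -/

import Mathlib

open MeasureTheory Filter Topology Set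
open scoped ENNReal NNReal

namespace Balayage

variable {X : Type*} [TopologicalSpace X] [T2Space X] [LocallyCompactSpace X]
  [MeasurableSpace X] [BorelSpace X]

/-- The potential `κμ(x) := ∫ κ(x,y) dμ(y)`. -/
noncomputable def pot (κ : X → X → ℝ≥0∞) (μ : Measure X) (x : X) : ℝ≥0∞ :=
  ∫⁻ y, κ x y ∂μ

/-- The mutual energy `κ(μ,ν) := ∬ κ(x,y) d(μ⊗ν)(x,y)`. -/
noncomputable def energy (κ : X → X → ℝ≥0∞) (μ ν : Measure X) : ℝ≥0∞ :=
  ∫⁻ x, pot κ ν x ∂μ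

/-- A positive Radon measure: locally finite and inner regular. -/
def IsRadon (μ : Measure X) : Prop :=
  μ.InnerRegular ∧ IsLocallyFiniteMeasure μ

/-- `E⁺`: the positive Radon measures of finite energy. -/
def Eplus (κ : X → X → ℝ≥0∞) : Set (Measure X) :=
  {μ | IsRadon μ ∧ energy κ μ μ < ⊤}

/-- `μ` is concentrated on `A`: `A` is `μ`-measurable and `X∖A` is locally `μ`-negligible. -/
def ConcOn (μ : Measure X) (A : Set X) : Prop :=
  NullMeasurableSet A μ ∧ ∀ K : Set X, IsCompact K → μ (Aᶜ ∩ K) = 0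

/-- `E⁺_A`: measures of finite energy concentrated on `A`. -/
def EplusOn (κ : X → X → ℝ≥0∞) (A : Set X) : Set (Measure X) :=
  {μ ∈ Eplus κ | ConcOn μ A}

/-- The inner capacity `c_*(A)`. -/
noncomputable def innerCap (κ : X → X → ℝ≥0∞) (A : Set X) : ℝ≥0∞ :=
  (⨅ μ ∈ {μ ∈ EplusOn κ A | μ Set.univ = 1}, energy κ μ μ)⁻¹

/-- `P` holds nearly everywhere on `A`: the set where it fails has inner capacity zero. -/
def NEOn (κ : X → X → ℝ≥0∞) (A : Set X) (P : X → Prop) : Prop :=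
  innerCap κ {x | x ∈ A ∧ ¬ P x} = 0

/-- The outer capacity `c^*(A)`. -/
noncomputable def outerCap (κ : X → X → ℝ≥0∞) (A : Set X) : ℝ≥0∞ :=
  ⨅ D ∈ {D : Set X | IsOpen D ∧ A ⊆ D}, innerCap κ D

/-- `P` holds quasi-everywhere on `A`: the set where it fails has outer capacity zero. -/
def QEOn (κ : X → X → ℝ≥0∞) (A : Set X) (P : X → Prop) : Prop :=
  outerCap κ {x | x ∈ A ∧ ¬ P x} = 0

/-- The class `Λ_{A,μ}` of measures `ν ∈ E⁺` with `κν ≥ κμ` n.e. on `A`. -/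
def InnerLam (κ : X → X → ℝ≥0∞) (A : Set X) (μ : Measure X) : Set (Measure X) :=
  {ν ∈ Eplus κ | NEOn κ A (fun x => pot κ μ x ≤ pot κ ν x)}

/-- The class `Λ*_{A,μ}` of measures `ν ∈ E⁺` with `κν ≥ κμ` q.e. on `A`. -/
def OuterLam (κ : X → X → ℝ≥0∞) (A : Set X) (μ : Measure X) : Set (Measure X) :=
  {ν ∈ Eplus κ | QEOn κ A (fun x => pot κ μ x ≤ pot κ ν x)}

/-- `b` is the inner balayage `μ^A`: the measure of minimal potential in `Λ_{A,μ}`. -/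
def IsInnerBal (κ : X → X → ℝ≥0∞) (A : Set X) (μ b : Measure X) : Prop :=
  b ∈ InnerLam κ A μ ∧ ∀ ν ∈ InnerLam κ A μ, ∀ x, pot κ b x ≤ pot κ ν x

/-- `b` is the outer balayage `μ^{*A}`: the measure of minimal potential in `Λ*_{A,μ}`. -/
def IsOuterBal (κ : X → X → ℝ≥0∞) (A : Set X) (μ b : Measure X) : Prop :=
  b ∈ OuterLam κ A μ ∧ ∀ ν ∈ OuterLam κ A μ, ∀ x, pot κ b x ≤ pot κ ν x

/-- The strong (energy) distance `‖μ − ν‖`. -/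
noncomputable def strDist (κ : X → X → ℝ≥0∞) (μ ν : Measure X) : ℝ :=
  Real.sqrt ((energy κ μ μ).toReal - 2 * (energy κ μ ν).toReal + (energy κ ν ν).toReal)

/-- The energy principle (strict positive definiteness). -/
def EnergyPrinciple (κ : X → X → ℝ≥0∞) : Prop :=
  ∀ μ ∈ Eplus κ, ∀ ν ∈ Eplus κ,
    2 * energy κ μ ν ≤ energy κ μ μ + energy κ ν ν ∧
      (2 * energy κ μ ν = energy κ μ μ + energy κ ν ν → μ = ν)

/-- Vague convergence of a net of measures along a filter. -/
def VagueConv {ι : Type*} (F : Filter ι) (m : ι → Measure X) (ν : Measure X) : Prop :=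
  ∀ f : X → ℝ, Continuous f → HasCompactSupport f →
    Tendsto (fun i => ∫ x, f x ∂(m i)) F (nhds (∫ x, f x ∂ν))

/-- A net of measures is strong Cauchy (for the energy metric) along a filter. -/
def StrongCauchy (κ : X → X → ℝ≥0∞) {ι : Type*} (F : Filter ι) (m : ι → Measure X) : Prop :=
  ∀ ε : ℝ, 0 < ε → ∃ s ∈ F, ∀ i ∈ s, ∀ j ∈ s, strDist κ (m i) (m j) < ε

/-- The consistency principle: every strong Cauchy net in `E⁺` converges strongly
to each of its vague limit points. -/
def Consistent (κ : X → X → ℝ≥0∞) : Prop :=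
  ∀ (ι : Type) (F : Filter ι) (m : ι → Measure X), F.NeBot →
    (∀ i, m i ∈ Eplus κ) → StrongCauchy κ F m →
    ∀ ν : Measure X, (∃ G : Filter ι, G ≤ F ∧ G.NeBot ∧ VagueConv G m ν) →
      Tendsto (fun i => strDist κ (m i) ν) F (nhds 0)

/-- The domination principle. -/
def Domination (κ : X → X → ℝ≥0∞) : Prop :=
  ∀ μ ∈ Eplus κ, ∀ ν ∈ Eplus κ,
    (∀ᵐ x ∂μ, pot κ μ x ≤ pot κ ν x) → ∀ x, pot κ μ x ≤ pot κ ν x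

/-- A kernel: symmetric and lower semicontinuous. -/
structure IsKernel (κ : X → X → ℝ≥0∞) : Prop where
  symm : ∀ x y, κ x y = κ y x
  lsc : LowerSemicontinuous (Function.uncurry κ)

/-- `E'_A`: the strong closure of `E⁺_A` within `E⁺`. -/
def EclosOn (κ : X → X → ℝ≥0∞) (A : Set X) : Set (Measure X) :=
  {ν ∈ Eplus κ | ∀ ε : ℝ, 0 < ε → ∃ μ ∈ EplusOn κ A, strDist κ ν μ < ε}

/-- The (real-valued) potential of the signed measure `λ = lp − lm`. -/
noncomputable def spot (κ : X → X → ℝ≥0∞) (lp lm : Measure X) (x : X) : ℝ :=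
  (pot κ lp x).toReal - (pot κ lm x).toReal

/-- Assumption (A2): every `f ∈ C_c(X)` is the limit, uniformly with supports in one fixed
compact set, of a sequence of potentials of signed measures of finite energy that are
continuous and compactly supported. -/
def A2 (κ : X → X → ℝ≥0∞) : Prop :=
  ∀ f : X → ℝ, Continuous f → HasCompactSupport f →
    ∃ (K : Set X) (lp lm : ℕ → Measure X), IsCompact K ∧ tsupport f ⊆ K ∧
      (∀ j, lp j ∈ Eplus κ ∧ lm j ∈ Eplus κ) ∧
      (∀ j x, pot κ (lp j) x ≠ ⊤ ∨ pot κ (lm j) x ≠ ⊤) ∧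
      (∀ j, Continuous (spot κ (lp j) (lm j))) ∧
      (∀ j, tsupport (spot κ (lp j) (lm j)) ⊆ K) ∧
      TendstoUniformly (fun j => spot κ (lp j) (lm j)) f atTop

section Aux

set_option linter.unusedSectionVars false

variable [SecondCountableTopology X]

universe u

theorem isRadon_iff {μ : Measure X} : IsRadon μ ↔ IsLocallyFiniteMeasure μ :=
  ⟨fun h => h.2, fun h => ⟨inferInstance, h⟩⟩

theorem isLocallyFinite_of_mem {κ : X → X → ℝ≥0∞} {μ : Measure X} (h : μ ∈ Eplus κ) :
    IsLocallyFiniteMeasure μ := h.1.2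

theorem sigmaFinite_of_mem {κ : X → X → ℝ≥0∞} {μ : Measure X} (h : μ ∈ Eplus κ) :
    SigmaFinite μ :=
  have := isLocallyFinite_of_mem h
  inferInstance

theorem IsKernel.lsc_right {κ : X → X → ℝ≥0∞} (hker : IsKernel κ) (x : X) :
    LowerSemicontinuous (κ x) :=
  LowerSemicontinuous.comp hker.lsc (g := fun y => (x, y)) (by fun_prop)

theorem IsKernel.lsc_left {κ : X → X → ℝ≥0∞} (hker : IsKernel κ) (y : X) :
    LowerSemicontinuous (fun x => κ x y) :=
  LowerSemicontinuous.comp hker.lsc (g := fun x => (x, y)) (by fun_prop)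

theorem IsKernel.measurable_right {κ : X → X → ℝ≥0∞} (hker : IsKernel κ) (x : X) :
    Measurable (κ x) := (hker.lsc_right x).measurable

theorem lowerSemicontinuous_pot {κ : X → X → ℝ≥0∞} (hker : IsKernel κ) (μ : Measure X) :
    LowerSemicontinuous (pot κ μ) := by
  rw [lowerSemicontinuous_iff_le_liminf]
  intro x
  calc pot κ μ x ≤ ∫⁻ y, liminf (fun x' => κ x' y) (𝓝 x) ∂μ :=
        lintegral_mono fun y => lowerSemicontinuous_iff_le_liminf.1 (hker.lsc_left y) x
    _ ≤ _ := lintegral_liminf_le fun x' => hker.measurable_right x'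

theorem measurable_pot {κ : X → X → ℝ≥0∞} (hker : IsKernel κ) (μ : Measure X) :
    Measurable (pot κ μ) := (lowerSemicontinuous_pot hker μ).measurable

theorem pot_add (κ : X → X → ℝ≥0∞) (μ ν : Measure X) (x : X) :
    pot κ (μ + ν) x = pot κ μ x + pot κ ν x := lintegral_add_measure _ _ _

theorem pot_smul (κ : X → X → ℝ≥0∞) (c : ℝ≥0) (μ : Measure X) (x : X) :
    pot κ (c • μ) x = c * pot κ μ x := by
  rw [pot, lintegral_smul_measure, ENNReal.smul_def, smul_eq_mul, pot]

theorem pot_mono (κ : X → X → ℝ≥0∞) {μ ν : Measure X} (h : μ ≤ ν) (x : X) :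
    pot κ μ x ≤ pot κ ν x := lintegral_mono' h le_rfl

theorem pot_zero (κ : X → X → ℝ≥0∞) (x : X) : pot κ 0 x = 0 := lintegral_zero_measure _

theorem energy_comm {κ : X → X → ℝ≥0∞} (hker : IsKernel κ) (μ ν : Measure X) [SFinite μ]
    [SFinite ν] : energy κ μ ν = energy κ ν μ := by
  unfold energy pot
  rw [lintegral_lintegral_swap hker.lsc.measurable.aemeasurable]
  simp_rw [hker.symm]

theorem energy_comm_of_mem {κ : X → X → ℝ≥0∞} (hker : IsKernel κ) {μ ν : Measure X}
    (hμ : μ ∈ Eplus κ) (hν : ν ∈ Eplus κ) : energy κ μ ν = energy κ ν μ :=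
  have := sigmaFinite_of_mem hμ
  have := sigmaFinite_of_mem hν
  energy_comm hker μ ν

theorem energy_add_left (κ : X → X → ℝ≥0∞) (μ₁ μ₂ ν : Measure X) :
    energy κ (μ₁ + μ₂) ν = energy κ μ₁ ν + energy κ μ₂ ν := lintegral_add_measure _ _ _

theorem energy_smul_left (κ : X → X → ℝ≥0∞) (c : ℝ≥0) (μ ν : Measure X) :
    energy κ (c • μ) ν = c * energy κ μ ν := by
  rw [energy, lintegral_smul_measure, ENNReal.smul_def, smul_eq_mul, energy]

theorem energy_add_right {κ : X → X → ℝ≥0∞} (hker : IsKernel κ) (μ ν₁ ν₂ : Measure X) :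
    energy κ μ (ν₁ + ν₂) = energy κ μ ν₁ + energy κ μ ν₂ := by
  simp only [energy, pot_add]
  exact lintegral_add_left (measurable_pot hker _) _

theorem energy_smul_right {κ : X → X → ℝ≥0∞} (hker : IsKernel κ) (c : ℝ≥0) (μ ν : Measure X) :
    energy κ μ (c • ν) = c * energy κ μ ν := by
  simp only [energy, pot_smul]
  exact lintegral_const_mul _ (measurable_pot hker _)

theorem energy_mono (κ : X → X → ℝ≥0∞) {μ₁ μ₂ ν₁ ν₂ : Measure X} (hμ : μ₁ ≤ μ₂) (hν : ν₁ ≤ ν₂) :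
    energy κ μ₁ ν₁ ≤ energy κ μ₂ ν₂ := lintegral_mono' hμ fun x => pot_mono κ hν x

theorem mem_Eplus_of_le {κ : X → X → ℝ≥0∞} {μ ν : Measure X} (hμ : μ ∈ Eplus κ) (h : ν ≤ μ) :
    ν ∈ Eplus κ :=
  have := isLocallyFinite_of_mem hμ
  ⟨isRadon_iff.2 (Measure.isLocallyFiniteMeasure_of_le h), (energy_mono κ h h).trans_lt hμ.2⟩

theorem zero_mem_Eplus (κ : X → X → ℝ≥0∞) : (0 : Measure X) ∈ Eplus κ :=
  ⟨isRadon_iff.2 inferInstance, by simp [energy]⟩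

theorem energy_ne_top {κ : X → X → ℝ≥0∞} (hE : EnergyPrinciple κ) {μ ν : Measure X}
    (hμ : μ ∈ Eplus κ) (hν : ν ∈ Eplus κ) : energy κ μ ν ≠ ⊤ := by
  intro h
  have h1 := (hE μ hμ ν hν).1
  rw [h, ENNReal.mul_top (by norm_num), top_le_iff] at h1
  exact (ENNReal.add_lt_top.2 ⟨hμ.2, hν.2⟩).ne h1

theorem add_mem_Eplus {κ : X → X → ℝ≥0∞} (hker : IsKernel κ) (hE : EnergyPrinciple κ)
    {μ ν : Measure X} (hμ : μ ∈ Eplus κ) (hν : ν ∈ Eplus κ) : μ + ν ∈ Eplus κ := by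
  have := isLocallyFinite_of_mem hμ
  have := isLocallyFinite_of_mem hν
  refine ⟨isRadon_iff.2 ⟨fun x => ?_⟩, ?_⟩
  · obtain ⟨s, hs, hμs⟩ := μ.finiteAt_nhds x
    obtain ⟨t, ht, hνt⟩ := ν.finiteAt_nhds x
    refine ⟨s ∩ t, inter_mem hs ht, ?_⟩
    rw [Measure.add_apply]
    exact ENNReal.add_lt_top.2 ⟨(measure_mono inter_subset_left).trans_lt hμs,
      (measure_mono inter_subset_right).trans_lt hνt⟩
  rw [energy_add_left, energy_add_right hker, energy_add_right hker]
  simp [lt_top_iff_ne_top, energy_ne_top hE, hμ, hν]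

theorem smul_mem_Eplus {κ : X → X → ℝ≥0∞} (hker : IsKernel κ) (c : ℝ≥0)
    {μ : Measure X} (hμ : μ ∈ Eplus κ) : c • μ ∈ Eplus κ := by
  have := isLocallyFinite_of_mem hμ
  refine ⟨isRadon_iff.2 inferInstance, ?_⟩
  rw [energy_smul_left, energy_smul_right hker]
  exact ENNReal.mul_lt_top (by simp) (ENNReal.mul_lt_top (by simp) hμ.2)

/-- A positive semidefinite real kernel is the Gram kernel of a map into an inner product space. -/
theorem exists_feature_map {ι : Type u} (k : ι → ι → ℝ) (hsymm : ∀ i j, k i j = k j i)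
    (hpos : ∀ f : ι →₀ ℝ, 0 ≤ f.sum fun i a => f.sum fun j b => a * b * k i j) :
    ∃ (H : Type u) (_ : NormedAddCommGroup H) (_ : InnerProductSpace ℝ H) (Φ : ι → H),
      ∀ i j, inner ℝ (Φ i) (Φ j) = k i j := by
  let core : PreInnerProductSpace.Core ℝ (ι →₀ ℝ) :=
    { inner := fun f g => f.sum fun i a => g.sum fun j b => a * b * k i j
      conj_inner_symm := fun f g => by
        rw [Finsupp.sum_comm]
        simp only [conj_trivial]
        refine Finset.sum_congr rfl fun i _ => Finset.sum_congr rfl fun j _ => ?_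
        simp only [hsymm j i]
        ring
      add_left := fun _ _ _ => by
        rw [Finsupp.sum_add_index'] <;> simp [← Finsupp.sum_add, add_mul]
      smul_left := fun _ _ _ => by
        rw [Finsupp.sum_smul_index] <;> simp [Finsupp.mul_sum, ← mul_assoc]
      re_inner_nonneg := hpos }
  let : SeminormedAddCommGroup (ι →₀ ℝ) :=
    InnerProductSpace.Core.toSeminormedAddCommGroup (𝕜 := ℝ)
  let : InnerProductSpace ℝ (ι →₀ ℝ) := .ofCore core
  refine ⟨SeparationQuotient (ι →₀ ℝ), inferInstance, inferInstance,
    fun i => SeparationQuotient.mk (Finsupp.single i 1), fun i j => ?_⟩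
  rw [SeparationQuotient.inner_mk_mk]
  change (Finsupp.single i (1 : ℝ)).sum (fun i a =>
    (Finsupp.single j (1 : ℝ)).sum fun j b => a * b * k i j) = _
  simp

theorem sum_smul_mem_Eplus {κ : X → X → ℝ≥0∞} (hker : IsKernel κ) (hE : EnergyPrinciple κ)
    (s : Finset (Eplus κ)) (c : Eplus κ → ℝ≥0) :
    (∑ i ∈ s, c i • (i : Measure X)) ∈ Eplus κ := by
  classical
  induction s using Finset.induction_on with
  | empty => simpa using zero_mem_Eplus κ
  | insert a s ha ih =>
    rw [Finset.sum_insert ha]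
    exact add_mem_Eplus hker hE (smul_mem_Eplus hker _ a.2) ih

theorem energy_sum_smul_left {κ : X → X → ℝ≥0∞} (hker : IsKernel κ) (hE : EnergyPrinciple κ)
    (s : Finset (Eplus κ)) (c : Eplus κ → ℝ≥0) {ν : Measure X} (hν : ν ∈ Eplus κ) :
    (energy κ (∑ i ∈ s, c i • (i : Measure X)) ν).toReal
      = ∑ i ∈ s, (c i : ℝ) * (energy κ i ν).toReal := by
  classical
  induction s using Finset.induction_on with
  | empty => simp [energy]
  | insert a s ha ih =>
    rw [Finset.sum_insert ha, Finset.sum_insert ha, energy_add_left, ENNReal.toReal_add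
      (energy_ne_top hE (smul_mem_Eplus hker _ a.2) hν)
      (energy_ne_top hE (sum_smul_mem_Eplus hker hE s c) hν), ih, energy_smul_left]
    simp

/-- The energy is the Gram kernel of a map of `E⁺` into an inner product space. -/
theorem exists_energy_map {X : Type u} [TopologicalSpace X] [T2Space X] [LocallyCompactSpace X]
    [MeasurableSpace X] [BorelSpace X] [SecondCountableTopology X] {κ : X → X → ℝ≥0∞}
    (hker : IsKernel κ) (hE : EnergyPrinciple κ) :
    ∃ (H : Type u) (_ : NormedAddCommGroup H) (_ : InnerProductSpace ℝ H) (Φ : Measure X → H),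
      ∀ μ ∈ Eplus κ, ∀ ν ∈ Eplus κ, inner ℝ (Φ μ) (Φ ν) = (energy κ μ ν).toReal := by
  obtain ⟨H, i1, i2, Φ, hΦ⟩ := exists_feature_map
    (fun μ ν : Eplus κ => (energy κ (μ : Measure X) ν).toReal)
    (fun μ ν => by rw [energy_comm_of_mem hker μ.2 ν.2]) (fun f => by
      let P : Measure X := ∑ i ∈ f.support, (f i).toNNReal • (i : Measure X)
      let N : Measure X := ∑ i ∈ f.support, (-f i).toNNReal • (i : Measure X)
      have hP : P ∈ Eplus κ := sum_smul_mem_Eplus hker hE _ _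
      have hN : N ∈ Eplus κ := sum_smul_mem_Eplus hker hE _ _
      have key : ∀ ν ∈ Eplus κ, (energy κ P ν).toReal - (energy κ N ν).toReal
          = ∑ i ∈ f.support, f i * (energy κ i ν).toReal := by
        intro ν hν
        rw [energy_sum_smul_left hker hE _ _ hν, energy_sum_smul_left hker hE _ _ hν,
          ← Finset.sum_sub_distrib]
        refine Finset.sum_congr rfl fun i _ => ?_
        rw [← sub_mul, Real.coe_toNNReal', Real.coe_toNNReal', max_zero_sub_max_neg_zero_eq_self]
      have hsum : (f.sum fun i a => f.sum fun j b => a * b * (energy κ (i : Measure X) j).toReal)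
          = ((energy κ P P).toReal - (energy κ N P).toReal)
            - ((energy κ P N).toReal - (energy κ N N).toReal) := by
        rw [key P hP, key N hN, ← Finset.sum_sub_distrib, Finsupp.sum]
        refine Finset.sum_congr rfl fun i _ => ?_
        rw [energy_comm_of_mem hker i.2 hP, energy_comm_of_mem hker i.2 hN, ← mul_sub,
          key i i.2, Finsupp.sum, Finset.mul_sum]
        refine Finset.sum_congr rfl fun j _ => ?_
        rw [energy_comm_of_mem hker i.2 j.2]
        ring
      rw [hsum, energy_comm_of_mem hker hN hP]
      have h := ENNReal.toReal_mono (ENNReal.add_lt_top.2 ⟨hP.2, hN.2⟩).ne (hE P hP N hN).1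
      rw [ENNReal.toReal_mul, ENNReal.toReal_add hP.2.ne hN.2.ne, ENNReal.toReal_ofNat] at h
      linarith)
  classical
  refine ⟨H, i1, i2, fun μ => if h : μ ∈ Eplus κ then Φ ⟨μ, h⟩ else 0, fun μ hμ ν hν => ?_⟩
  simp [hμ, hν, hΦ]

/-- `Φ` realizes the mutual energy as an inner product. -/
def IsEnergyMap {H : Type*} [NormedAddCommGroup H] [InnerProductSpace ℝ H] (κ : X → X → ℝ≥0∞)
    (Φ : Measure X → H) : Prop :=
  ∀ μ ∈ Eplus κ, ∀ ν ∈ Eplus κ, inner ℝ (Φ μ) (Φ ν) = (energy κ μ ν).toReal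

section EnergyMap

variable {H : Type*} [NormedAddCommGroup H] [InnerProductSpace ℝ H] {κ : X → X → ℝ≥0∞}
  {Φ : Measure X → H}

theorem IsEnergyMap.norm_sq (hΦ : IsEnergyMap κ Φ) {μ : Measure X} (hμ : μ ∈ Eplus κ) :
    ‖Φ μ‖ ^ 2 = (energy κ μ μ).toReal := by
  rw [← hΦ μ hμ μ hμ, real_inner_self_eq_norm_sq]

theorem IsEnergyMap.strDist_eq (hΦ : IsEnergyMap κ Φ) {μ ν : Measure X} (hμ : μ ∈ Eplus κ)
    (hν : ν ∈ Eplus κ) : strDist κ μ ν = ‖Φ μ - Φ ν‖ := by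
  rw [strDist, ← hΦ μ hμ ν hν, ← hΦ.norm_sq hμ, ← hΦ.norm_sq hν, ← norm_sub_sq_real,
    Real.sqrt_sq (norm_nonneg _)]

theorem IsEnergyMap.inner_add_left (hker : IsKernel κ) (hE : EnergyPrinciple κ)
    (hΦ : IsEnergyMap κ Φ) {μ ν σ : Measure X} (hμ : μ ∈ Eplus κ) (hν : ν ∈ Eplus κ)
    (hσ : σ ∈ Eplus κ) :
    inner ℝ (Φ (μ + ν)) (Φ σ) = inner ℝ (Φ μ) (Φ σ) + inner ℝ (Φ ν) (Φ σ) := by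
  rw [hΦ _ (add_mem_Eplus hker hE hμ hν) _ hσ, hΦ _ hμ _ hσ, hΦ _ hν _ hσ, energy_add_left,
    ENNReal.toReal_add (energy_ne_top hE hμ hσ) (energy_ne_top hE hν hσ)]

theorem IsEnergyMap.inner_smul_left (hker : IsKernel κ)
    (hΦ : IsEnergyMap κ Φ) {μ σ : Measure X} (c : ℝ≥0) (hμ : μ ∈ Eplus κ)
    (hσ : σ ∈ Eplus κ) :
    inner ℝ (Φ (c • μ)) (Φ σ) = c * inner ℝ (Φ μ) (Φ σ) := by
  rw [hΦ _ (smul_mem_Eplus hker c hμ) _ hσ, hΦ _ hμ _ hσ, energy_smul_left]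
  simp

theorem IsEnergyMap.map_add (hker : IsKernel κ) (hE : EnergyPrinciple κ)
    (hΦ : IsEnergyMap κ Φ) {μ ν : Measure X} (hμ : μ ∈ Eplus κ) (hν : ν ∈ Eplus κ) :
    Φ (μ + ν) = Φ μ + Φ ν := by
  have h := add_mem_Eplus hker hE hμ hν
  rw [← sub_eq_zero, ← inner_self_eq_zero (𝕜 := ℝ)]
  simp only [inner_sub_right, inner_add_right, inner_sub_left, _root_.inner_add_left,
    hΦ.inner_add_left hker hE hμ hν h, hΦ.inner_add_left hker hE hμ hν hμ,
    hΦ.inner_add_left hker hE hμ hν hν, real_inner_comm (Φ (μ + ν))]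
  ring

theorem IsEnergyMap.map_smul (hker : IsKernel κ) (hΦ : IsEnergyMap κ Φ) {μ : Measure X}
    (c : ℝ≥0) (hμ : μ ∈ Eplus κ) : Φ (c • μ) = (c : ℝ) • Φ μ := by
  have h := smul_mem_Eplus hker c hμ
  rw [← sub_eq_zero, ← inner_self_eq_zero (𝕜 := ℝ)]
  simp only [inner_sub_right, inner_sub_left, _root_.inner_smul_right, _root_.inner_smul_left,
    hΦ.inner_smul_left hker c hμ h, hΦ.inner_smul_left hker c hμ hμ,
    real_inner_comm (Φ (c • μ)), conj_trivial]
  ring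

end EnergyMap

theorem lintegral_eq_lintegral_measure_lt {g : X → ℝ≥0∞} (hg : Measurable g) (μ : Measure X)
    [SFinite μ] :
    ∫⁻ x, g x ∂μ = ∫⁻ t in Ioi (0 : ℝ), μ {x | ENNReal.ofReal t < g x} := by
  have hm : MeasurableSet {p : X × ℝ | ENNReal.ofReal p.2 < g p.1} :=
    measurableSet_lt (by fun_prop) (by fun_prop)
  have h1 : ∀ x, g x = ∫⁻ t in Ioi (0 : ℝ),
      {p : X × ℝ | ENNReal.ofReal p.2 < g p.1}.indicator 1 (x, t) := by
    intro x
    have : (fun t => {p : X × ℝ | ENNReal.ofReal p.2 < g p.1}.indicator (1 : X × ℝ → ℝ≥0∞) (x, t))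
        = {t : ℝ | ENNReal.ofReal t < g x}.indicator 1 := by
      ext t; simp [indicator]
    rw [this, lintegral_indicator_one (measurableSet_lt (by fun_prop) (by fun_prop)),
      Measure.restrict_apply (measurableSet_lt (by fun_prop) (by fun_prop))]
    rcases eq_or_ne (g x) ⊤ with h | h
    · simp [h]
    · have : {t : ℝ | ENNReal.ofReal t < g x} ∩ Ioi 0 = Ioo 0 (g x).toReal := by
        ext t
        simp only [mem_inter_iff, mem_ofPred_eq, mem_Ioi, mem_Ioo]
        refine ⟨fun ⟨a, b⟩ => ⟨b, (ENNReal.ofReal_lt_iff_lt_toReal b.le h).1 a⟩,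
          fun ⟨a, b⟩ => ⟨(ENNReal.ofReal_lt_iff_lt_toReal a.le h).2 b, a⟩⟩
      rw [this]
      simp [h]
  calc ∫⁻ x, g x ∂μ = ∫⁻ x, (∫⁻ t in Ioi (0 : ℝ),
      {p : X × ℝ | ENNReal.ofReal p.2 < g p.1}.indicator 1 (x, t)) ∂μ := by simp_rw [← h1]
    _ = ∫⁻ t in Ioi (0 : ℝ), ∫⁻ x,
      {p : X × ℝ | ENNReal.ofReal p.2 < g p.1}.indicator 1 (x, t) ∂μ := by
        rw [lintegral_lintegral_swap]
        exact (measurable_one.indicator hm).aemeasurable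
    _ = _ := by
        refine lintegral_congr fun t => ?_
        have : (fun x => {p : X × ℝ | ENNReal.ofReal p.2 < g p.1}.indicator
            (1 : X × ℝ → ℝ≥0∞) (x, t)) = {x | ENNReal.ofReal t < g x}.indicator 1 := by
          ext x; simp [indicator]
        rw [this, lintegral_indicator_one (measurableSet_lt (by fun_prop) (by fun_prop))]

theorem measure_open_le_liminf_of_vagueConv {m : ℕ → Measure X} {ν : Measure X}
    (hm : ∀ n, IsLocallyFiniteMeasure (m n)) [IsLocallyFiniteMeasure ν]
    (h : VagueConv atTop m ν) {O : Set X} (hO : IsOpen O) :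
    ν O ≤ liminf (fun n => m n O) atTop := by
  rw [hO.measure_eq_iSup_isCompact]
  refine iSup₂_le fun K hKO => iSup_le fun hK => ?_
  obtain ⟨f, hf1, hf0, hfc, hf⟩ := exists_continuous_one_zero_of_isCompact hK
    hO.isClosed_compl (disjoint_compl_right_iff_subset.2 hKO)
  have hintegral : ∀ σ : Measure X, IsLocallyFiniteMeasure σ →
      ENNReal.ofReal (∫ x, f x ∂σ) = ∫⁻ x, ENNReal.ofReal (f x) ∂σ := fun σ _ =>
    ofReal_integral_eq_lintegral_ofReal (f.continuous.integrable_of_hasCompactSupport hfc)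
      (ae_of_all _ fun x => (hf x).1)
  have hlim := (ENNReal.tendsto_ofReal (h f f.continuous hfc))
  calc ν K = ∫⁻ x, K.indicator 1 x ∂ν := by rw [lintegral_indicator_one hK.measurableSet]
    _ ≤ ∫⁻ x, ENNReal.ofReal (f x) ∂ν := by
        refine lintegral_mono fun x => ?_
        by_cases hx : x ∈ K
        · simp [hx, hf1 hx]
        · simp [hx]
    _ = liminf (fun n => ENNReal.ofReal (∫ x, f x ∂(m n))) atTop := by
        rw [← hintegral ν inferInstance, hlim.liminf_eq]
    _ ≤ liminf (fun n => m n O) atTop := by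
        refine liminf_le_liminf (Eventually.of_forall fun n => ?_)
        rw [hintegral _ (hm n), ← lintegral_indicator_one hO.measurableSet]
        refine lintegral_mono fun x => ?_
        by_cases hx : x ∈ O
        · simp [hx, (hf x).2]
        · simp [hx, hf0 hx]

theorem lintegral_le_liminf_of_vagueConv {m : ℕ → Measure X} {ν : Measure X}
    (hm : ∀ n, IsLocallyFiniteMeasure (m n)) [IsLocallyFiniteMeasure ν]
    (h : VagueConv atTop m ν) {g : X → ℝ≥0∞} (hg : LowerSemicontinuous g) :
    ∫⁻ x, g x ∂ν ≤ liminf (fun n => ∫⁻ x, g x ∂(m n)) atTop := by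
  have hlc : ∀ n, ∫⁻ x, g x ∂(m n) = ∫⁻ t in Ioi (0 : ℝ), m n {x | ENNReal.ofReal t < g x} :=
    fun n => have := hm n; lintegral_eq_lintegral_measure_lt hg.measurable _
  simp_rw [hlc]
  rw [lintegral_eq_lintegral_measure_lt hg.measurable]
  refine (lintegral_mono fun t => measure_open_le_liminf_of_vagueConv hm h
    (hg.isOpen_preimage (ENNReal.ofReal t))).trans (lintegral_liminf_le fun n => ?_)
  refine Antitone.measurable fun s t hst => measure_mono fun x hx => ?_
  exact (ENNReal.ofReal_le_ofReal hst).trans_lt hx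

theorem IsKernel.diag_ne_zero {κ : X → X → ℝ≥0∞} (hker : IsKernel κ) (hE : EnergyPrinciple κ)
    (x : X) : κ x x ≠ 0 := by
  intro h
  have hen : energy κ (Measure.dirac x) (Measure.dirac x) = 0 := by
    have : ∀ y, pot κ (Measure.dirac x) y = κ y x := fun y =>
      lintegral_dirac' _ (hker.measurable_right y)
    rw [energy, lintegral_dirac' _ (measurable_pot hker _), this, h]
  have h1 := (hE (Measure.dirac x) ⟨isRadon_iff.2 inferInstance, by simp [hen]⟩ 0
    (zero_mem_Eplus κ)).2 (by rw [hen]; simp [energy, pot_zero])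
  exact Measure.dirac_ne_zero h1

theorem exists_mass_bound {κ : X → X → ℝ≥0∞} (hker : IsKernel κ) (hE : EnergyPrinciple κ)
    {K : Set X} (hK : IsCompact K) :
    ∃ C : ℝ≥0, ∀ μ : Measure X, μ K ≤ C * (1 + energy κ μ μ) := by
  refine hK.induction_on (p := fun s => ∃ C : ℝ≥0, ∀ μ : Measure X, μ s ≤ C * (1 + energy κ μ μ))
    ⟨0, by simp⟩ (fun s t hst ⟨C, hC⟩ => ⟨C, fun μ => (measure_mono hst).trans (hC μ)⟩)
    (fun s t ⟨C, hC⟩ ⟨D, hD⟩ => ⟨C + D, fun μ => ?_⟩) fun x _ => ?_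
  · refine (measure_union_le s t).trans ((add_le_add (hC μ) (hD μ)).trans_eq ?_)
    push_cast
    ring
  · obtain ⟨c, hc0, hc⟩ := ENNReal.lt_iff_exists_nnreal_btwn.1
      (pos_iff_ne_zero.2 (hker.diag_ne_zero hE x))
    have hc0' : (c : ℝ≥0∞) ≠ 0 := hc0.ne'
    have hev := hker.lsc (x, x) c hc
    rw [nhds_prod_eq] at hev
    obtain ⟨V, hV, hVc⟩ := (mem_prod_same_iff).1 hev
    obtain ⟨W, hWV, hWo, hxW⟩ := mem_nhds_iff.1 hV
    refine ⟨W, mem_nhdsWithin_of_mem_nhds (hWo.mem_nhds hxW), 1 + c⁻¹, fun μ => ?_⟩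
    have h1 : c * (μ W * μ W) ≤ energy κ μ μ := by
      calc (c : ℝ≥0∞) * (μ W * μ W) = ∫⁻ _ in W, ∫⁻ _ in W, (c : ℝ≥0∞) ∂μ ∂μ := by
            simp [mul_assoc]
        _ ≤ ∫⁻ x in W, ∫⁻ y in W, κ x y ∂μ ∂μ :=
            setLIntegral_mono' hWo.measurableSet fun a ha =>
              setLIntegral_mono' hWo.measurableSet fun b hb =>
                (hVc (show (a, b) ∈ V ×ˢ V from ⟨hWV ha, hWV hb⟩)).le
        _ ≤ energy κ μ μ :=
            lintegral_mono' Measure.restrict_le_self fun a =>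
              lintegral_mono' Measure.restrict_le_self le_rfl
    have h2 : μ W * μ W ≤ (c : ℝ≥0∞)⁻¹ * energy κ μ μ := by
      rw [← one_mul (μ W * μ W), ← ENNReal.inv_mul_cancel hc0' ENNReal.coe_ne_top, mul_assoc]
      gcongr
    have h3 : μ W ≤ 1 + μ W * μ W := by
      rcases le_total (μ W) 1 with h | h
      · exact h.trans le_self_add
      · exact (le_mul_of_one_le_left' h).trans le_add_self
    calc μ W ≤ 1 + (c : ℝ≥0∞)⁻¹ * energy κ μ μ := h3.trans (by gcongr)
      _ ≤ (1 + (c : ℝ≥0∞)⁻¹) * 1 + (1 + (c : ℝ≥0∞)⁻¹) * energy κ μ μ := by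
          gcongr
          · simp
          · exact le_add_self
      _ = _ := by
          rw [← mul_add, ENNReal.coe_add, ENNReal.coe_inv (by simpa using hc0'), ENNReal.coe_one]

theorem exists_cauchySeq_near_minimal {H : Type*} [NormedAddCommGroup H] [InnerProductSpace ℝ H]
    {S : ℕ → Set H} (hanti : Antitone S)
    (hmid : ∀ n, ∀ x ∈ S n, ∀ y ∈ S n, (1 / 2 : ℝ) • (x + y) ∈ S n)
    (v : H) {R : ℝ} (hR : ∀ n, ∃ x ∈ S n, ‖x - v‖ ≤ R) :
    ∃ c : ℕ → H, (∀ n, c n ∈ S n) ∧ CauchySeq c ∧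
      ∀ n, ∀ x ∈ S n, ‖c n - v‖ ^ 2 ≤ ‖x - v‖ ^ 2 + 1 / (n + 1) := by
  set d : ℕ → ℝ := fun n => sInf ((fun x => ‖x - v‖ ^ 2) '' S n) with hd
  have hbdd : ∀ n, BddBelow ((fun x => ‖x - v‖ ^ 2) '' S n) := fun n =>
    ⟨0, by rintro _ ⟨x, -, rfl⟩; positivity⟩
  have hdle : ∀ n, ∀ x ∈ S n, d n ≤ ‖x - v‖ ^ 2 := fun n x hx =>
    csInf_le (hbdd n) ⟨x, hx, rfl⟩
  have hdmono : Monotone d := fun n m hnm => by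
    obtain ⟨x, hx, -⟩ := hR m
    exact csInf_le_csInf (hbdd n) ⟨_, x, hx, rfl⟩ (image_mono (hanti hnm))
  have hdR : BddAbove (range d) := by
    refine ⟨R ^ 2, ?_⟩
    rintro _ ⟨n, rfl⟩
    obtain ⟨x, hx, hxR⟩ := hR n
    exact (hdle n x hx).trans (by gcongr)
  have hex : ∀ n : ℕ, ∃ x ∈ S n, ‖x - v‖ ^ 2 ≤ d n + 1 / (n + 1) := fun n => by
    obtain ⟨x, hx, -⟩ := hR n
    obtain ⟨_, ⟨y, hy, rfl⟩, hlt⟩ := exists_lt_of_csInf_lt (s := (fun x => ‖x - v‖ ^ 2) '' S n)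
      ⟨_, x, hx, rfl⟩ (show sInf _ < d n + 1 / (n + 1) from lt_add_of_pos_right _ (by positivity))
    exact ⟨y, hy, hlt.le⟩
  choose c hc hcd using hex
  refine ⟨c, hc, ?_, fun n x hx => (hcd n).trans (by have := hdle n x hx; gcongr)⟩
  have key : ∀ n m, n ≤ m → ‖c n - c m‖ ^ 2 ≤ 2 * ((⨆ k, d k) - d n) + 4 * (1 / ((n : ℝ) + 1)) := by
    intro n m hnm
    have hp := parallelogram_law_with_norm ℝ (c n - v) (c m - v)
    have h1 := hdle n _ (hmid n _ (hc n) _ (hanti hnm (hc m)))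
    have h2 : (1 / 2 : ℝ) • (c n + c m) - v = (1 / 2 : ℝ) • ((c n - v) + (c m - v)) := by
      module
    rw [h2, norm_smul, mul_pow] at h1
    rw [show (c n - v) - (c m - v) = c n - c m by abel] at hp
    have h3 : d m ≤ ⨆ k, d k := le_ciSup hdR m
    have h4 : (1 : ℝ) / (m + 1) ≤ 1 / (n + 1) := by gcongr
    have h5 := hcd n
    have h6 := hcd m
    norm_num at h1
    simp only [one_div] at *
    nlinarith
  have hlim : Tendsto (fun n : ℕ => 2 * ((⨆ k, d k) - d n) + 4 * (1 / ((n : ℝ) + 1))) atTop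
      (𝓝 0) := by
    have h1 := tendsto_atTop_ciSup hdmono hdR
    have h2 := ((tendsto_const_nhds (x := ⨆ k, d k)).sub h1).const_mul 2
    have h3 := (tendsto_one_div_add_atTop_nhds_zero_nat (𝕜 := ℝ)).const_mul 4
    simpa using h2.add h3
  refine cauchySeq_of_le_tendsto_0' (fun n => √(2 * ((⨆ k, d k) - d n) + 4 * (1 / ((n : ℝ) + 1))))
    (fun n m hnm => ?_) (by simpa using hlim.sqrt)
  rw [dist_eq_norm]
  exact Real.le_sqrt_of_sq_le (key n m hnm)

theorem exists_vagueConv_of_cauchySeq {m : ℕ → Measure X}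
    (hm : ∀ n, IsLocallyFiniteMeasure (m n))
    (h : ∀ f : X → ℝ, Continuous f → HasCompactSupport f → CauchySeq fun n => ∫ x, f x ∂(m n)) :
    ∃ ν : Measure X, IsLocallyFiniteMeasure ν ∧ VagueConv atTop m ν := by
  have h1 : ∀ f : CompactlySupportedContinuousMap X ℝ, ∃ a : ℝ,
      Tendsto (fun n => ∫ x, f x ∂(m n)) atTop (𝓝 a) := fun f =>
    cauchySeq_tendsto_of_complete (h f f.continuous f.hasCompactSupport)
  choose L hL using h1
  have hintegral : ∀ (f : CompactlySupportedContinuousMap X ℝ) n, Integrable f (m n) := fun f n =>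
    f.continuous.integrable_of_hasCompactSupport f.hasCompactSupport
  let Λ : CompactlySupportedContinuousMap X ℝ →ₚ[ℝ] ℝ := PositiveLinearMap.mk₀
    { toFun := L
      map_add' := fun f g => tendsto_nhds_unique (hL (f + g)) (by
        refine ((hL f).add (hL g)).congr fun n => ?_
        rw [← integral_add (hintegral f n) (hintegral g n)]
        rfl)
      map_smul' := fun c f => tendsto_nhds_unique (hL (c • f)) (by
        refine ((hL f).const_mul c).congr fun n => ?_
        rw [← integral_const_mul]
        rfl) }
    (fun f hf => ge_of_tendsto' (hL f) fun n => integral_nonneg fun x => hf x)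
  have hreg := RealRMK.regular_rieszMeasure Λ
  refine ⟨RealRMK.rieszMeasure Λ, inferInstance, fun f hf hfc => ?_⟩
  have := RealRMK.integral_rieszMeasure Λ ⟨⟨f, hf⟩, hfc⟩
  have h2 := hL ⟨⟨f, hf⟩, hfc⟩
  change ∫ x, f x ∂(RealRMK.rieszMeasure Λ) = L ⟨⟨f, hf⟩, hfc⟩ at this
  rw [this]
  exact h2

theorem integral_spot {κ : X → X → ℝ≥0∞} (hker : IsKernel κ) (hE : EnergyPrinciple κ)
    {lp lm μ : Measure X} (hlp : lp ∈ Eplus κ) (hlm : lm ∈ Eplus κ) (hμ : μ ∈ Eplus κ) :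
    ∫ x, spot κ lp lm x ∂μ = (energy κ μ lp).toReal - (energy κ μ lm).toReal := by
  have h : ∀ l ∈ Eplus κ, ∫ x, (pot κ l x).toReal ∂μ = (energy κ μ l).toReal ∧
      Integrable (fun x => (pot κ l x).toReal) μ := fun l hl =>
    ⟨integral_toReal (measurable_pot hker l).aemeasurable
      (ae_lt_top (measurable_pot hker l) (energy_ne_top hE hμ hl)),
      integrable_toReal_of_lintegral_ne_top (measurable_pot hker l).aemeasurable
        (energy_ne_top hE hμ hl)⟩
  simp only [spot]
  rw [integral_sub (h lp hlp).2 (h lm hlm).2, (h lp hlp).1, (h lm hlm).1]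

theorem IsEnergyMap.energy_le {H : Type*} [NormedAddCommGroup H] [InnerProductSpace ℝ H]
    {κ : X → X → ℝ≥0∞} {Φ : Measure X → H} (hE : EnergyPrinciple κ) (hΦ : IsEnergyMap κ Φ)
    {μ ν : Measure X} (hμ : μ ∈ Eplus κ) (hν : ν ∈ Eplus κ) :
    energy κ μ ν ≤ ENNReal.ofReal (‖Φ μ‖ * ‖Φ ν‖) := by
  rw [← ENNReal.ofReal_toReal (energy_ne_top hE hμ hν), ← hΦ μ hμ ν hν]
  exact ENNReal.ofReal_le_ofReal (real_inner_le_norm _ _)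

theorem exists_limit {H : Type*} [NormedAddCommGroup H] [InnerProductSpace ℝ H]
    {κ : X → X → ℝ≥0∞} {Φ : Measure X → H} (hker : IsKernel κ) (hE : EnergyPrinciple κ)
    (hC : Consistent κ) (hA2 : A2 κ) (hΦ : IsEnergyMap κ Φ) {m : ℕ → Measure X}
    (hm : ∀ n, m n ∈ Eplus κ) (hcau : CauchySeq fun n => Φ (m n)) :
    ∃ ν ∈ Eplus κ, VagueConv atTop m ν ∧ Tendsto (fun n => Φ (m n)) atTop (𝓝 (Φ ν)) := by
  obtain ⟨R, hR0, hR⟩ : ∃ R : ℝ, 0 ≤ R ∧ ∀ n, ‖Φ (m n)‖ ≤ R := by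
    obtain ⟨R, hR⟩ := hcau.isBounded_range.exists_norm_le
    exact ⟨R, (norm_nonneg _).trans (hR _ ⟨0, rfl⟩), fun n => hR _ ⟨n, rfl⟩⟩
  set C : ℝ≥0∞ := ENNReal.ofReal (R * R) with hCdef
  have hen : ∀ i j, energy κ (m i) (m j) ≤ C := fun i j =>
    (hΦ.energy_le hE (hm i) (hm j)).trans (ENNReal.ofReal_le_ofReal
      (mul_le_mul (hR i) (hR j) (norm_nonneg _) hR0))
  have hlf : ∀ n, IsLocallyFiniteMeasure (m n) := fun n => isLocallyFinite_of_mem (hm n)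
  have hmass : ∀ K : Set X, IsCompact K → ∃ M : ℝ, 0 ≤ M ∧ ∀ n, (m n).real K ≤ M := by
    intro K hK
    obtain ⟨D, hD⟩ := exists_mass_bound hker hE hK
    refine ⟨(D * (1 + C)).toReal, ENNReal.toReal_nonneg, fun n => ?_⟩
    refine ENNReal.toReal_mono ?_ ((hD (m n)).trans (by gcongr; exact hen n n))
    exact ENNReal.mul_ne_top ENNReal.coe_ne_top (ENNReal.add_ne_top.2 ⟨by simp, by simp [hCdef]⟩)
  obtain ⟨ν, hν, hvague⟩ := exists_vagueConv_of_cauchySeq hlf fun f hf hfc => by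
    obtain ⟨K, lp, lm, hK, hfK, hl, -, hsc, hsK, hunif⟩ := hA2 f hf hfc
    obtain ⟨M, hM0, hM⟩ := hmass K hK
    rw [Metric.cauchySeq_iff]
    intro ε hε
    obtain ⟨j, hj⟩ := (Metric.tendstoUniformly_iff.1 hunif (ε / (4 * (M + 1)))
      (by positivity)).exists
    have hdiff : ∀ n, |∫ x, f x ∂(m n) - ∫ x, spot κ (lp j) (lm j) x ∂(m n)| ≤ ε / 4 := by
      intro n
      have := hlf n
      have hsi : Integrable (spot κ (lp j) (lm j)) (m n) :=
        (hsc j).integrable_of_hasCompactSupport (HasCompactSupport.of_support_subset_isCompact hK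
          ((subset_tsupport _).trans (hsK j)))
      rw [← integral_sub (hf.integrable_of_hasCompactSupport hfc) hsi,
        ← setIntegral_eq_integral_of_forall_compl_eq_zero (s := K), ← Real.norm_eq_abs]
      · refine (norm_setIntegral_le_of_norm_le_const (C := ε / (4 * (M + 1))) hK.measure_lt_top
          fun x _ => (hj x).le).trans ?_
        calc ε / (4 * (M + 1)) * (m n).real K ≤ ε / (4 * (M + 1)) * (M + 1) := by
              gcongr; linarith [hM n]
          _ = ε / 4 := by field_simp
      · intro x hx
        rw [image_eq_zero_of_notMem_tsupport (fun h => hx (hfK h)),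
          image_eq_zero_of_notMem_tsupport (fun h => hx (hsK j h)), sub_zero]
    have hcs : CauchySeq fun n => ∫ x, spot κ (lp j) (lm j) x ∂(m n) := by
      have h1 : ∀ l ∈ Eplus κ, CauchySeq fun n => (energy κ (m n) l).toReal := fun l hlE => by
        have : (fun n => (energy κ (m n) l).toReal) = fun n => inner ℝ (Φ l) (Φ (m n)) := by
          ext n
          rw [real_inner_comm, hΦ _ (hm n) _ hlE]
        rw [this]
        exact hcau.map (innerSL ℝ (Φ l)).uniformContinuous
      simp_rw [fun n => integral_spot hker hE (hl j).1 (hl j).2 (hm n)]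
      exact uniformContinuous_sub.comp_cauchySeq ((h1 _ (hl j).1).prodMk (h1 _ (hl j).2))
    obtain ⟨N, hN⟩ := Metric.cauchySeq_iff.1 hcs (ε / 4) (by positivity)
    refine ⟨N, fun a ha b hb => ?_⟩
    have h1 := hN a ha b hb
    have h2 := hdiff a
    have h3 := hdiff b
    rw [Real.dist_eq] at *
    rw [abs_le] at h2 h3
    rw [abs_lt] at h1 ⊢
    constructor <;> linarith [h1.1, h1.2, h2.1, h2.2, h3.1, h3.2]
  have hsm : ∀ i, energy κ ν (m i) ≤ C := fun i =>
    (lintegral_le_liminf_of_vagueConv hlf hvague (lowerSemicontinuous_pot hker (m i))).trans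
      ((liminf_le_liminf (Eventually.of_forall fun j => hen j i)).trans_eq (by simp))
  have hνE : ν ∈ Eplus κ := by
    refine ⟨isRadon_iff.2 hν, lt_of_le_of_lt ?_ (ENNReal.ofReal_lt_top (r := R * R))⟩
    calc energy κ ν ν ≤ ∫⁻ x, liminf (fun i => pot κ (m i) x) atTop ∂ν :=
          lintegral_mono fun x => lintegral_le_liminf_of_vagueConv hlf hvague (hker.lsc_right x)
      _ ≤ liminf (fun i => energy κ ν (m i)) atTop :=
          lintegral_liminf_le fun i => measurable_pot hker (m i)
      _ ≤ C := (liminf_le_liminf (Eventually.of_forall hsm)).trans_eq (by simp)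
  refine ⟨ν, hνE, hvague, ?_⟩
  have hconv := hC ℕ atTop m inferInstance hm (fun ε hε => by
    obtain ⟨N, hN⟩ := Metric.cauchySeq_iff.1 hcau ε hε
    refine ⟨Ici N, Ici_mem_atTop N, fun i hi j hj => ?_⟩
    rw [hΦ.strDist_eq (hm i) (hm j), ← dist_eq_norm]
    exact hN i hi j hj) ν ⟨atTop, le_rfl, inferInstance, hvague⟩
  rw [tendsto_iff_norm_sub_tendsto_zero]
  simpa only [fun i => hΦ.strDist_eq (hm i) hνE] using hconv

theorem concOn_iff {μ : Measure X} {A : Set X} : ConcOn μ A ↔ μ Aᶜ = 0 := by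
  refine ⟨fun h => ?_, fun h => ⟨?_, fun K _ => measure_mono_null inter_subset_left h⟩⟩
  · rw [← inter_univ Aᶜ, ← iUnion_compactCovering X, inter_iUnion, measure_iUnion_null_iff]
    exact fun n => h.2 _ (isCompact_compactCovering X n)
  · exact NullMeasurableSet.compl_iff.1 (NullMeasurableSet.of_null h)

theorem mem_EplusOn_iff {κ : X → X → ℝ≥0∞} {μ : Measure X} {A : Set X} :
    μ ∈ EplusOn κ A ↔ μ ∈ Eplus κ ∧ μ Aᶜ = 0 := and_congr_right fun _ => concOn_iff

theorem EplusOn_mono (κ : X → X → ℝ≥0∞) {A B : Set X} (h : A ⊆ B) : EplusOn κ A ⊆ EplusOn κ B :=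
  fun _ hμ => mem_EplusOn_iff.2 ⟨hμ.1,
    measure_mono_null (compl_subset_compl.2 h) (mem_EplusOn_iff.1 hμ).2⟩

theorem restrict_mem_Eplus {κ : X → X → ℝ≥0∞} {μ : Measure X} (hμ : μ ∈ Eplus κ) (S : Set X) :
    μ.restrict S ∈ Eplus κ := mem_Eplus_of_le hμ Measure.restrict_le_self

theorem restrict_mem_EplusOn {κ : X → X → ℝ≥0∞} {μ : Measure X} {A : Set X}
    (hμ : μ ∈ EplusOn κ A) (S : Set X) : μ.restrict S ∈ EplusOn κ A :=
  mem_EplusOn_iff.2 ⟨restrict_mem_Eplus hμ.1 S,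
    le_antisymm ((Measure.restrict_le_self _).trans_eq (mem_EplusOn_iff.1 hμ).2) bot_le⟩

theorem restrict_mem_EplusOn_self {κ : X → X → ℝ≥0∞} {μ : Measure X} (hμ : μ ∈ Eplus κ)
    {S : Set X} (hS : MeasurableSet S) : μ.restrict S ∈ EplusOn κ S :=
  mem_EplusOn_iff.2 ⟨restrict_mem_Eplus hμ S, by simp [Measure.restrict_apply hS.compl]⟩

theorem zero_mem_EplusOn (κ : X → X → ℝ≥0∞) (A : Set X) : (0 : Measure X) ∈ EplusOn κ A :=
  mem_EplusOn_iff.2 ⟨zero_mem_Eplus κ, by simp⟩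

theorem add_mem_EplusOn {κ : X → X → ℝ≥0∞} (hker : IsKernel κ) (hE : EnergyPrinciple κ)
    {μ ν : Measure X} {A : Set X} (hμ : μ ∈ EplusOn κ A) (hν : ν ∈ EplusOn κ A) :
    μ + ν ∈ EplusOn κ A :=
  mem_EplusOn_iff.2 ⟨add_mem_Eplus hker hE hμ.1 hν.1, by
    simp [(mem_EplusOn_iff.1 hμ).2, (mem_EplusOn_iff.1 hν).2]⟩

theorem smul_mem_EplusOn {κ : X → X → ℝ≥0∞} (hker : IsKernel κ) (c : ℝ≥0) {μ : Measure X}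
    {A : Set X} (hμ : μ ∈ EplusOn κ A) : c • μ ∈ EplusOn κ A :=
  mem_EplusOn_iff.2 ⟨smul_mem_Eplus hker c hμ.1, by simp [(mem_EplusOn_iff.1 hμ).2]⟩

theorem innerCap_eq_zero_iff {κ : X → X → ℝ≥0∞} (hker : IsKernel κ) {A : Set X} :
    innerCap κ A = 0 ↔ ∀ σ ∈ EplusOn κ A, σ = 0 := by
  rw [innerCap, ENNReal.inv_eq_zero, iInf₂_eq_top]
  constructor
  · intro h σ hσ
    by_contra hne
    have hlf := isLocallyFinite_of_mem hσ.1
    have huniv : σ (⋃ n, compactCovering X n) ≠ 0 := by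
      rwa [iUnion_compactCovering, Measure.measure_univ_ne_zero]
    obtain ⟨n, hn⟩ := not_forall.1 (mt measure_iUnion_null_iff.2 huniv)
    have hfin : σ (compactCovering X n) ≠ ⊤ := (isCompact_compactCovering X n).measure_lt_top.ne
    set a := (σ (compactCovering X n)).toNNReal with ha
    have ha' : (a : ℝ≥0∞) = σ (compactCovering X n) := ENNReal.coe_toNNReal hfin
    have ha0 : a ≠ 0 := fun h0 => hn (by rw [← ha', h0]; rfl)
    have hmem := smul_mem_EplusOn hker a⁻¹ (restrict_mem_EplusOn hσ (compactCovering X n))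
    refine hmem.1.2.ne (h _ ⟨hmem, ?_⟩)
    rw [Measure.smul_apply, Measure.restrict_apply_univ, ← ha', ENNReal.smul_def, smul_eq_mul,
      ENNReal.coe_inv ha0, ENNReal.inv_mul_cancel (by simpa using ha0) ENNReal.coe_ne_top]
  · rintro h σ ⟨hσ, h1⟩
    rw [h σ hσ] at h1
    simp at h1

theorem innerCap_inter_eq_zero_iff {κ : X → X → ℝ≥0∞} (hker : IsKernel κ) {A N : Set X}
    (hN : MeasurableSet N) : innerCap κ (A ∩ N) = 0 ↔ ∀ σ ∈ EplusOn κ A, σ N = 0 := by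
  rw [innerCap_eq_zero_iff hker]
  constructor
  · intro h σ hσ
    rw [← Measure.restrict_eq_zero]
    refine h _ (mem_EplusOn_iff.2 ⟨restrict_mem_Eplus hσ.1 N, ?_⟩)
    rw [compl_inter]
    exact measure_union_null (mem_EplusOn_iff.1 (restrict_mem_EplusOn hσ N)).2
      (mem_EplusOn_iff.1 (restrict_mem_EplusOn_self hσ.1 hN)).2
  · intro h σ hσ
    have h1 := h σ (EplusOn_mono κ inter_subset_left hσ)
    have h2 := (mem_EplusOn_iff.1 (EplusOn_mono κ inter_subset_right hσ)).2
    rw [← Measure.measure_univ_eq_zero, ← union_compl_self N]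
    exact measure_union_null h1 h2

theorem mem_InnerLam_iff {κ : X → X → ℝ≥0∞} (hker : IsKernel κ) {A : Set X} {μ ν : Measure X} :
    ν ∈ InnerLam κ A μ ↔
      ν ∈ Eplus κ ∧ ∀ σ ∈ EplusOn κ A, ∀ᵐ x ∂σ, pot κ μ x ≤ pot κ ν x := by
  refine and_congr_right fun _ => ?_
  exact innerCap_inter_eq_zero_iff hker
    (measurableSet_le (measurable_pot hker μ) (measurable_pot hker ν)).compl

theorem InnerLam_anti {κ : X → X → ℝ≥0∞} (hker : IsKernel κ) {A B : Set X} (h : A ⊆ B)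
    (μ : Measure X) : InnerLam κ B μ ⊆ InnerLam κ A μ := fun ν hν => by
  rw [mem_InnerLam_iff hker] at hν ⊢
  exact ⟨hν.1, fun σ hσ => hν.2 σ (EplusOn_mono κ h hσ)⟩

/-- `b` is the strong projection of `μ` on the closure of `E⁺_B`, with minimal potential. -/
structure IsProj (κ : X → X → ℝ≥0∞) (B : Set X) (μ b : Measure X) : Prop where
  mem : b ∈ Eplus κ
  orth : ∀ σ ∈ EplusOn κ B, energy κ σ b = energy κ σ μ
  clos : ∀ ε : ℝ, 0 < ε → ∃ τ ∈ EplusOn κ B, strDist κ b τ < ε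
  min : ∀ ν ∈ InnerLam κ B μ, ∀ x, pot κ b x ≤ pot κ ν x

theorem IsProj.ae_eq {κ : X → X → ℝ≥0∞} (hker : IsKernel κ) {B : Set X}
    {μ b : Measure X} (h : IsProj κ B μ b) {σ : Measure X} (hσ : σ ∈ EplusOn κ B) :
    pot κ b =ᵐ[σ] pot κ μ :=
  have := sigmaFinite_of_mem hσ.1
  ae_eq_of_forall_setLIntegral_eq_of_sigmaFinite (measurable_pot hker b) (measurable_pot hker μ)
    fun S _ _ => h.orth _ (restrict_mem_EplusOn hσ S)

theorem IsProj.mem_InnerLam {κ : X → X → ℝ≥0∞} (hker : IsKernel κ) {B : Set X}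
    {μ b : Measure X} (h : IsProj κ B μ b) : b ∈ InnerLam κ B μ :=
  (mem_InnerLam_iff hker).2 ⟨h.mem, fun _ hσ => (h.ae_eq hker hσ).symm.le⟩

section EnergyMap

variable {H : Type*} [NormedAddCommGroup H] [InnerProductSpace ℝ H] {κ : X → X → ℝ≥0∞}
  {Φ : Measure X → H}

theorem IsEnergyMap.image_midpoint (hker : IsKernel κ) (hE : EnergyPrinciple κ)
    (hΦ : IsEnergyMap κ Φ) {μ ν : Measure X} (hμ : μ ∈ Eplus κ) (hν : ν ∈ Eplus κ) :
    Φ ((1 / 2 : ℝ≥0) • (μ + ν)) = (1 / 2 : ℝ) • (Φ μ + Φ ν) := by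
  rw [hΦ.map_smul hker _ (add_mem_Eplus hker hE hμ hν), hΦ.map_add hker hE hμ hν]
  simp

theorem inner_nonneg_of_variation {v w : H}
    (h : ∀ t : ℝ, 0 < t → t ≤ 1 → ‖v‖ ^ 2 ≤ ‖v + t • w‖ ^ 2) : 0 ≤ inner ℝ v w := by
  by_contra! hneg
  have key : ∀ t : ℝ, 0 < t → t ≤ 1 → 0 ≤ 2 * inner ℝ v w + t * ‖w‖ ^ 2 := by
    intro t ht ht1
    have h1 := h t ht ht1
    rw [norm_add_sq_real, inner_smul_right, norm_smul, mul_pow, Real.norm_eq_abs, sq_abs] at h1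
    have h2 : 0 ≤ t * (2 * inner ℝ v w + t * ‖w‖ ^ 2) := by nlinarith
    exact nonneg_of_mul_nonneg_right h2 ht
  have h1 := key (min 1 (-inner ℝ v w / (‖w‖ ^ 2 + 1)))
    (lt_min one_pos (div_pos (by linarith) (by positivity))) (min_le_left _ _)
  have h2 : min 1 (-inner ℝ v w / (‖w‖ ^ 2 + 1)) * ‖w‖ ^ 2 ≤ -inner ℝ v w := by
    calc min 1 (-inner ℝ v w / (‖w‖ ^ 2 + 1)) * ‖w‖ ^ 2
        ≤ (-inner ℝ v w / (‖w‖ ^ 2 + 1)) * (‖w‖ ^ 2 + 1) := by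
          gcongr
          · exact div_nonneg (by linarith) (by positivity)
          · exact min_le_right _ _
          · linarith
      _ = -inner ℝ v w := by field_simp
  linarith

theorem exists_isProj_of_isClosed (hker : IsKernel κ) (hE : EnergyPrinciple κ)
    (hC : Consistent κ) (hD : Domination κ) (hA2 : A2 κ) (hΦ : IsEnergyMap κ Φ)
    {K : Set X} (hK : IsClosed K) {μ : Measure X} (hμ : μ ∈ Eplus κ) :
    ∃ b, IsProj κ K μ b := by
  obtain ⟨c, hc, hcau, hmin⟩ := exists_cauchySeq_near_minimal (S := fun _ => Φ '' EplusOn κ K)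
    antitone_const (by
      rintro _ _ ⟨σ, hσ, rfl⟩ _ ⟨τ, hτ, rfl⟩
      exact ⟨_, smul_mem_EplusOn hker _ (add_mem_EplusOn hker hE hσ hτ),
        hΦ.image_midpoint hker hE hσ.1 hτ.1⟩) (Φ μ)
    (fun _ => ⟨_, ⟨0, zero_mem_EplusOn κ K, rfl⟩, le_rfl⟩)
  choose m hm hmc using hc
  obtain ⟨b, hb, hvague, hlim⟩ := exists_limit hker hE hC hA2 hΦ (fun n => (hm n).1)
    (by simpa only [hmc] using hcau)
  simp only [hmc] at hlim
  have hbK : b ∈ EplusOn κ K := by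
    have := isLocallyFinite_of_mem hb
    refine mem_EplusOn_iff.2 ⟨hb, le_antisymm ?_ bot_le⟩
    refine (measure_open_le_liminf_of_vagueConv (fun n => isLocallyFinite_of_mem (hm n).1) hvague
      hK.isOpen_compl).trans_eq ?_
    simp [fun n => (mem_EplusOn_iff.1 (hm n)).2]
  have hbmin : ∀ σ ∈ EplusOn κ K, ‖Φ b - Φ μ‖ ^ 2 ≤ ‖Φ σ - Φ μ‖ ^ 2 := fun σ hσ => by
    refine le_of_tendsto_of_tendsto' ((hlim.sub_const (Φ μ)).norm.pow 2) ?_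
      (fun n => hmin n _ ⟨σ, hσ, rfl⟩)
    simpa using (tendsto_one_div_add_atTop_nhds_zero_nat (𝕜 := ℝ)).const_add (‖Φ σ - Φ μ‖ ^ 2)
  have h1 : ∀ σ ∈ EplusOn κ K, energy κ σ μ ≤ energy κ σ b := fun σ hσ => by
    have h := inner_nonneg_of_variation (v := Φ b - Φ μ) (w := Φ σ) fun t ht _ => by
      have := hbmin _ (add_mem_EplusOn hker hE hbK (smul_mem_EplusOn hker t.toNNReal hσ))
      rw [hΦ.map_add hker hE hb (smul_mem_Eplus hker _ hσ.1), hΦ.map_smul hker _ hσ.1,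
        Real.coe_toNNReal t ht.le] at this
      rwa [sub_add_eq_add_sub]
    rw [real_inner_comm, inner_sub_right, hΦ _ hσ.1 _ hb, hΦ _ hσ.1 _ hμ, sub_nonneg] at h
    exact (ENNReal.toReal_le_toReal (energy_ne_top hE hσ.1 hμ) (energy_ne_top hE hσ.1 hb)).1 h
  have h2 : energy κ b b ≤ energy κ b μ := by
    have h := inner_nonneg_of_variation (v := Φ b - Φ μ) (w := -Φ b) fun t ht ht1 => by
      have := hbmin _ (smul_mem_EplusOn hker (1 - t).toNNReal hbK)
      rw [hΦ.map_smul hker _ hb, Real.coe_toNNReal _ (by linarith)] at this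
      convert this using 3
      module
    rw [inner_neg_right, real_inner_comm, inner_sub_right, hΦ _ hb _ hb, hΦ _ hb _ hμ] at h
    exact (ENNReal.toReal_le_toReal (energy_ne_top hE hb hb) (energy_ne_top hE hb hμ)).1
      (by linarith)
  have h3 : pot κ μ ≤ᵐ[b] pot κ b :=
    have := sigmaFinite_of_mem hb
    ae_le_of_forall_setLIntegral_le_of_sigmaFinite (measurable_pot hker μ)
      fun S _ _ => h1 _ (restrict_mem_EplusOn hbK S)
  have h4 : pot κ μ =ᵐ[b] pot κ b := ae_eq_of_ae_le_of_lintegral_le h3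
    (energy_ne_top hE hb hμ) (measurable_pot hker b).aemeasurable h2
  have h5 : ∀ x, pot κ b x ≤ pot κ μ x := hD b hb μ hμ h4.symm.le
  exact ⟨b,
    { mem := hb
      orth := fun σ hσ => le_antisymm (lintegral_mono h5) (h1 σ hσ)
      clos := fun ε hε => ⟨b, hbK, by simpa [hΦ.strDist_eq hb hb] using hε⟩
      min := fun ν hν => hD b hb ν hν.1 (by
        filter_upwards [((mem_InnerLam_iff hker).1 hν).2 b hbK] with x hx
        exact (h5 x).trans hx) }⟩

theorem inner_eq_zero_of_forall_near {x v : H}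
    (h : ∀ ε : ℝ, 0 < ε → ∃ y, ‖x - y‖ < ε ∧ inner ℝ y v = 0) : inner ℝ x v = 0 := by
  have : x ∈ closure {y | inner ℝ y v = 0} := Metric.mem_closure_iff.2 fun ε hε => by
    obtain ⟨y, hy, hyv⟩ := h ε hε
    exact ⟨y, hyv, by rwa [dist_eq_norm]⟩
  have hcl : IsClosed {y : H | inner ℝ y v = 0} := isClosed_eq (by fun_prop) continuous_const
  rwa [hcl.closure_eq] at this

theorem IsEnergyMap.inner_sub_eq_zero_iff (hE : EnergyPrinciple κ) (hΦ : IsEnergyMap κ Φ)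
    {σ b μ : Measure X} (hσ : σ ∈ Eplus κ) (hb : b ∈ Eplus κ) (hμ : μ ∈ Eplus κ) :
    inner ℝ (Φ σ) (Φ b - Φ μ) = 0 ↔ energy κ σ b = energy κ σ μ := by
  rw [inner_sub_right, sub_eq_zero, hΦ _ hσ _ hb, hΦ _ hσ _ hμ,
    ENNReal.toReal_eq_toReal_iff' (energy_ne_top hE hσ hb) (energy_ne_top hE hσ hμ)]

theorem exists_isProj_of_dense (hker : IsKernel κ) (hE : EnergyPrinciple κ)
    (hC : Consistent κ) (hA2 : A2 κ) (hΦ : IsEnergyMap κ Φ)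
    {B : ℕ → Set X} (hB : Monotone B) {A : Set X} (hBA : ∀ n, B n ⊆ A)
    (hdense : ∀ σ ∈ EplusOn κ A, ∀ ε : ℝ, 0 < ε → ∃ n, ∃ τ ∈ EplusOn κ (B n), strDist κ σ τ < ε)
    {μ : Measure X} (hμ : μ ∈ Eplus κ) {b : ℕ → Measure X} (hb : ∀ n, IsProj κ (B n) μ (b n)) :
    ∃ ν, IsProj κ A μ ν ∧ VagueConv atTop b ν ∧ Tendsto (fun n => Φ (b n)) atTop (𝓝 (Φ ν)) := by
  have horth : ∀ n m, n ≤ m → inner ℝ (Φ (b n)) (Φ (b m) - Φ μ) = 0 := by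
    intro n m hnm
    refine inner_eq_zero_of_forall_near fun ε hε => ?_
    obtain ⟨τ, hτ, hdist⟩ := (hb n).clos ε hε
    refine ⟨Φ τ, by rwa [← hΦ.strDist_eq (hb n).mem hτ.1],
      (hΦ.inner_sub_eq_zero_iff hE hτ.1 (hb m).mem hμ).2 ((hb m).orth τ ?_)⟩
    exact EplusOn_mono κ (hB hnm) hτ
  have hself : ∀ n, ‖Φ (b n)‖ ^ 2 = inner ℝ (Φ (b n)) (Φ μ) := fun n => by
    have := horth n n le_rfl
    rwa [inner_sub_right, real_inner_self_eq_norm_sq, sub_eq_zero] at this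
  have hdiff : ∀ n m, n ≤ m → ‖Φ (b n) - Φ (b m)‖ ^ 2 = ‖Φ (b m)‖ ^ 2 - ‖Φ (b n)‖ ^ 2 := by
    intro n m hnm
    have h1 := horth n m hnm
    rw [inner_sub_right, ← hself, sub_eq_zero] at h1
    rw [norm_sub_sq_real, h1]
    ring
  have hmono : Monotone fun n => ‖Φ (b n)‖ ^ 2 := fun n m hnm => by
    have := hdiff n m hnm
    have h2 := sq_nonneg ‖Φ (b n) - Φ (b m)‖
    change ‖Φ (b n)‖ ^ 2 ≤ ‖Φ (b m)‖ ^ 2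
    linarith
  have hbdd : BddAbove (range fun n => ‖Φ (b n)‖ ^ 2) := by
    refine ⟨‖Φ μ‖ ^ 2, ?_⟩
    rintro _ ⟨n, rfl⟩
    have h1 := real_inner_le_norm (Φ (b n)) (Φ μ)
    rw [← hself] at h1
    change ‖Φ (b n)‖ ^ 2 ≤ ‖Φ μ‖ ^ 2
    nlinarith [sq_nonneg (‖Φ (b n)‖ - ‖Φ μ‖)]
  have hcau : CauchySeq fun n => Φ (b n) := by
    refine cauchySeq_of_le_tendsto_0' (fun n => √((⨆ k, ‖Φ (b k)‖ ^ 2) - ‖Φ (b n)‖ ^ 2))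
      (fun n m hnm => ?_) ?_
    · rw [dist_eq_norm]
      refine Real.le_sqrt_of_sq_le ?_
      rw [hdiff n m hnm]
      exact sub_le_sub_right (le_ciSup hbdd m) _
    · have := ((tendsto_const_nhds (x := ⨆ k, ‖Φ (b k)‖ ^ 2)).sub
        (tendsto_atTop_ciSup hmono hbdd)).sqrt
      rwa [sub_self, Real.sqrt_zero] at this
  obtain ⟨ν, hν, hvague, hlim⟩ := exists_limit hker hE hC hA2 hΦ (fun n => (hb n).mem) hcau
  refine ⟨ν, ⟨hν, fun σ hσ => ?_, fun ε hε => ?_, fun τ hτ x => ?_⟩, hvague, hlim⟩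
  · rw [← hΦ.inner_sub_eq_zero_iff hE hσ.1 hν hμ]
    refine inner_eq_zero_of_forall_near fun ε hε => ?_
    obtain ⟨n, τ, hτ, hdist⟩ := hdense σ hσ ε hε
    refine ⟨Φ τ, by rwa [← hΦ.strDist_eq hσ.1 hτ.1], ?_⟩
    refine tendsto_nhds_unique (Filter.Tendsto.inner (𝕜 := ℝ)
      (tendsto_const_nhds (x := Φ τ)) (hlim.sub_const (Φ μ)))
      (tendsto_const_nhds.congr' ?_)
    filter_upwards [eventually_ge_atTop n] with m hm
    exact ((hΦ.inner_sub_eq_zero_iff hE hτ.1 (hb m).mem hμ).2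
      ((hb m).orth τ (EplusOn_mono κ (hB hm) hτ))).symm
  · obtain ⟨n, hn⟩ := (Metric.tendsto_nhds.1 hlim (ε / 2) (half_pos hε)).exists
    obtain ⟨τ, hτ, hdist⟩ := (hb n).clos (ε / 2) (half_pos hε)
    refine ⟨τ, EplusOn_mono κ (hBA n) hτ, ?_⟩
    rw [hΦ.strDist_eq (hb n).mem hτ.1, ← dist_eq_norm] at hdist
    rw [hΦ.strDist_eq hν hτ.1, ← dist_eq_norm]
    rw [dist_comm] at hn
    linarith [dist_triangle (Φ ν) (Φ (b n)) (Φ τ)]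
  · have := isLocallyFinite_of_mem hν
    refine (lintegral_le_liminf_of_vagueConv (fun n => isLocallyFinite_of_mem (hb n).mem) hvague
      (hker.lsc_right x)).trans ?_
    refine (liminf_le_liminf (Eventually.of_forall fun n =>
      (hb n).min τ (InnerLam_anti hker (hBA n) μ hτ) x)).trans_eq (by simp)

theorem exists_strDist_restrict_lt (hker : IsKernel κ) (hE : EnergyPrinciple κ)
    {σ : Measure X} (hσ : σ ∈ Eplus κ) {S : ℕ → Set X} (hS : Monotone S)
    (h0 : σ (⋃ n, S n)ᶜ = 0) {ε : ℝ} (hε : 0 < ε) :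
    ∃ n, strDist κ σ (σ.restrict (S n)) < ε := by
  have hfin := energy_ne_top hE hσ hσ
  have hlim : Tendsto (fun n => (energy κ (σ.restrict (S n)) σ).toReal) atTop
      (𝓝 (energy κ σ σ).toReal) := by
    refine (ENNReal.tendsto_toReal hfin).comp ?_
    have h1 : energy κ σ σ = ⨆ n, energy κ (σ.restrict (S n)) σ := by
      simp only [energy]
      rw [← setLIntegral_iUnion_of_directed _ hS.directed_le,
        Measure.restrict_eq_self_of_ae_mem (s := ⋃ n, S n) (μ := σ)
          (by rwa [ae_iff, ← compl_def])]
    rw [h1]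
    exact tendsto_atTop_iSup fun n m hnm =>
      energy_mono κ (Measure.restrict_mono (hS hnm) le_rfl) le_rfl
  have hlim2 : Tendsto (fun n => √((energy κ σ σ).toReal
      - (energy κ (σ.restrict (S n)) σ).toReal)) atTop (𝓝 0) := by
    simpa using ((tendsto_const_nhds (x := (energy κ σ σ).toReal)).sub hlim).sqrt
  obtain ⟨n, hn⟩ := (hlim2.eventually (gt_mem_nhds hε)).exists
  refine ⟨n, lt_of_le_of_lt (Real.sqrt_le_sqrt ?_) hn⟩
  have hr := restrict_mem_Eplus hσ (S n)
  have h2 : (energy κ (σ.restrict (S n)) (σ.restrict (S n))).toReal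
      ≤ (energy κ (σ.restrict (S n)) σ).toReal :=
    ENNReal.toReal_mono (energy_ne_top hE hr hσ) (energy_mono κ le_rfl Measure.restrict_le_self)
  rw [energy_comm_of_mem hker hσ hr]
  linarith

theorem exists_isProj_of_isSigmaCompact (hker : IsKernel κ) (hE : EnergyPrinciple κ)
    (hC : Consistent κ) (hD : Domination κ) (hA2 : A2 κ) (hΦ : IsEnergyMap κ Φ)
    {B : Set X} (hB : IsSigmaCompact B) {μ : Measure X} (hμ : μ ∈ Eplus κ) :
    ∃ b, IsProj κ B μ b := by
  obtain ⟨K, hK, rfl⟩ := hB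
  have hcl : ∀ n, IsClosed (accumulate K n) := fun n => (isCompact_accumulate hK n).isClosed
  choose b hb using fun n => exists_isProj_of_isClosed hker hE hC hD hA2 hΦ (hcl n) hμ
  rw [← iUnion_accumulate]
  obtain ⟨ν, hν, -⟩ := exists_isProj_of_dense hker hE hC hA2 hΦ monotone_accumulate
    (fun n => subset_iUnion (accumulate K) n) (fun σ hσ ε hε => by
      obtain ⟨n, hn⟩ := exists_strDist_restrict_lt hker hE hσ.1 (S := accumulate K)
        monotone_accumulate (mem_EplusOn_iff.1 hσ).2 hε
      exact ⟨n, _, restrict_mem_EplusOn_self hσ.1 (hcl n).measurableSet, hn⟩) hμ hb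
  exact ⟨ν, hν⟩

end EnergyMap

theorem isSigmaCompact_of_isOpen {U : Set X} (hU : IsOpen U) : IsSigmaCompact U := by
  have := hU.locallyCompactSpace
  have h : IsSigmaCompact (univ : Set U) := isSigmaCompact_univ
  simpa using h.image continuous_subtype_val

theorem isSigmaCompact_of_isClosed {U : Set X} (hU : IsClosed U) : IsSigmaCompact U :=
  isSigmaCompact_univ.of_isClosed_subset hU (subset_univ _)

theorem isSigmaCompact_inter {s t : Set X} (hs : IsSigmaCompact s) (ht : IsSigmaCompact t) :
    IsSigmaCompact (s ∩ t) := by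
  obtain ⟨K, hK, rfl⟩ := hs
  obtain ⟨L, hL, rfl⟩ := ht
  simp_rw [iUnion_inter, inter_iUnion]
  exact isSigmaCompact_iUnion _ fun i => isSigmaCompact_iUnion_of_isCompact _ fun j =>
    (hK i).inter (hL j)

theorem measurableSet_of_isSigmaCompact {s : Set X} (hs : IsSigmaCompact s) : MeasurableSet s := by
  obtain ⟨K, hK, rfl⟩ := hs
  exact MeasurableSet.iUnion fun n => (hK n).measurableSet

theorem isSigmaCompact_setOf_lt {g h : X → ℝ≥0∞} (hg : LowerSemicontinuous g)
    (hh : LowerSemicontinuous h) : IsSigmaCompact {x | g x < h x} := by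
  have : {x | g x < h x} = ⋃ q : ℚ, {x | g x ≤ (Real.toNNReal q : ℝ≥0∞)} ∩
      {x | (Real.toNNReal q : ℝ≥0∞) < h x} := by
    ext x
    simp only [mem_ofPred_eq, mem_iUnion, mem_inter_iff]
    refine ⟨fun hx => ?_, fun ⟨q, h1, h2⟩ => h1.trans_lt h2⟩
    obtain ⟨q, -, h1, h2⟩ := ENNReal.lt_iff_exists_rat_btwn.1 hx
    exact ⟨q, h1.le, h2⟩
  rw [this]
  exact isSigmaCompact_iUnion _ fun q => isSigmaCompact_inter
    (isSigmaCompact_of_isClosed (hg.isClosed_preimage _))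
    (isSigmaCompact_of_isOpen (hh.isOpen_preimage _))

theorem innerCap_mono (κ : X → X → ℝ≥0∞) {A B : Set X} (h : A ⊆ B) :
    innerCap κ A ≤ innerCap κ B :=
  ENNReal.inv_le_inv.2 (biInf_mono fun _ hμ => ⟨EplusOn_mono κ h hμ.1, hμ.2⟩)

theorem innerCap_le_outerCap (κ : X → X → ℝ≥0∞) (A : Set X) : innerCap κ A ≤ outerCap κ A :=
  le_iInf₂ fun _ hD => innerCap_mono κ hD.2

theorem outerCap_le {κ : X → X → ℝ≥0∞} {A D : Set X} (hD : IsOpen D) (h : A ⊆ D) :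
    outerCap κ A ≤ innerCap κ D := iInf₂_le D ⟨hD, h⟩

theorem OuterLam_subset_InnerLam (κ : X → X → ℝ≥0∞) (A : Set X) (μ : Measure X) :
    OuterLam κ A μ ⊆ InnerLam κ A μ := fun _ hν =>
  ⟨hν.1, le_antisymm ((innerCap_le_outerCap κ _).trans_eq hν.2) bot_le⟩

theorem innerCap_le_of_measure_sq_le {κ : X → X → ℝ≥0∞} {D : Set X} {c : ℝ≥0∞} (hc : c ≠ ⊤)
    (h : ∀ μ ∈ Eplus κ, μ D ^ 2 ≤ c * energy κ μ μ) : innerCap κ D ≤ c := by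
  rw [innerCap, ENNReal.inv_le_iff_inv_le]
  refine le_iInf₂ fun μ hμ => ?_
  have h1 := h μ hμ.1.1
  have h2 : μ D = 1 := by
    refine le_antisymm ((measure_mono (subset_univ _)).trans_eq hμ.2) ?_
    rw [← hμ.2, ← union_compl_self D]
    exact (measure_union_le _ _).trans_eq (by rw [(mem_EplusOn_iff.1 hμ.1).2, add_zero])
  rw [h2, one_pow] at h1
  have hc0 : c ≠ 0 := by rintro rfl; simp at h1
  rw [← one_div]
  exact ENNReal.div_le_of_le_mul' h1

theorem measure_sq_le_innerCap_mul {κ : X → X → ℝ≥0∞} (hker : IsKernel κ)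
    {D : Set X} (hD : MeasurableSet D) (hfin : innerCap κ D ≠ ⊤) {μ : Measure X}
    (hμ : μ ∈ Eplus κ) : μ D ^ 2 ≤ innerCap κ D * energy κ μ μ := by
  have := isLocallyFinite_of_mem hμ
  have key : ∀ K ⊆ D, IsCompact K → μ K ^ 2 ≤ innerCap κ D * energy κ μ μ := by
    intro K hKD hK
    rcases eq_or_ne (μ K) 0 with h0 | h0
    · simp [h0]
    set a := (μ K).toNNReal
    have ha' : (a : ℝ≥0∞) = μ K := ENNReal.coe_toNNReal hK.measure_lt_top.ne
    have ha0 : (a : ℝ≥0∞) ≠ 0 := by rwa [ha']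
    have hmem := smul_mem_EplusOn hker a⁻¹
      (EplusOn_mono κ hKD (restrict_mem_EplusOn_self hμ hK.measurableSet))
    have huniv : (a⁻¹ • μ.restrict K) univ = 1 := by
      rw [Measure.smul_apply, Measure.restrict_apply_univ, ← ha', ENNReal.smul_def, smul_eq_mul,
        ENNReal.coe_inv (by simpa using ha0), ENNReal.inv_mul_cancel ha0 ENNReal.coe_ne_top]
    have h1 : (innerCap κ D)⁻¹ ≤ energy κ (a⁻¹ • μ.restrict K) (a⁻¹ • μ.restrict K) := by
      rw [innerCap, inv_inv]
      exact iInf₂_le _ ⟨hmem, huniv⟩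
    rw [energy_smul_left, energy_smul_right hker, ENNReal.coe_inv (by simpa using ha0)] at h1
    have h2 : (innerCap κ D)⁻¹ * (a : ℝ≥0∞) ^ 2 ≤ energy κ μ μ := by
      calc (innerCap κ D)⁻¹ * (a : ℝ≥0∞) ^ 2
          ≤ (a : ℝ≥0∞)⁻¹ * ((a : ℝ≥0∞)⁻¹ * energy κ (μ.restrict K) (μ.restrict K)) *
              (a : ℝ≥0∞) ^ 2 := by gcongr
        _ = ((a : ℝ≥0∞)⁻¹ * a) * ((a : ℝ≥0∞)⁻¹ * a) *
              energy κ (μ.restrict K) (μ.restrict K) := by ring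
        _ = energy κ (μ.restrict K) (μ.restrict K) := by
            rw [ENNReal.inv_mul_cancel ha0 ENNReal.coe_ne_top, one_mul, one_mul]
        _ ≤ energy κ μ μ := energy_mono κ Measure.restrict_le_self Measure.restrict_le_self
    rw [mul_comm] at h2
    rw [← ha', mul_comm (innerCap κ D), ← inv_inv (innerCap κ D), ← div_eq_mul_inv]
    exact (ENNReal.le_div_iff_mul_le (Or.inl (ENNReal.inv_ne_zero.2 hfin)) (Or.inr hμ.2.ne)).2 h2
  have h3 : μ D = ⨆ (K) (_ : K ⊆ D) (_ : IsCompact K), μ K := hD.measure_eq_iSup_isCompact μ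
  have h4 : μ D ≤ (innerCap κ D * energy κ μ μ) ^ (1 / 2 : ℝ) := by
    rw [h3]
    refine iSup₂_le fun K hKD => iSup_le fun hK => ?_
    rw [one_div, ENNReal.le_rpow_inv_iff (by norm_num)]
    exact_mod_cast key K hKD hK
  rw [one_div, ENNReal.le_rpow_inv_iff (by norm_num)] at h4
  exact_mod_cast h4

theorem outerCap_iUnion_eq_zero {κ : X → X → ℝ≥0∞} (hker : IsKernel κ) {E : ℕ → Set X}
    (hE : ∀ n, outerCap κ (E n) = 0) : outerCap κ (⋃ n, E n) = 0 := by
  by_contra hne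
  obtain ⟨ε, hε0, hε⟩ := exists_between (lt_min one_pos (pos_iff_ne_zero.2 hne))
  rw [lt_min_iff] at hε
  obtain ⟨δ, hδ0, hδ⟩ := ENNReal.exists_pos_sum_of_countable hε0.ne' ℕ
  have hex : ∀ n, ∃ D, IsOpen D ∧ E n ⊆ D ∧ innerCap κ D < (δ n : ℝ≥0∞) ^ 2 := fun n => by
    have : outerCap κ (E n) < (δ n : ℝ≥0∞) ^ 2 := by
      rw [hE n]
      exact pos_iff_ne_zero.2 (pow_ne_zero 2 (by simpa using (hδ0 n).ne'))
    simp only [outerCap, iInf_lt_iff] at this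
    obtain ⟨D, hD, hlt⟩ := this
    exact ⟨D, hD.1, hD.2, hlt⟩
  choose D hDo hED hDc using hex
  have hcap : innerCap κ (⋃ n, D n) ≤ ε ^ 2 := by
    refine innerCap_le_of_measure_sq_le
      (ENNReal.pow_ne_top (hε.1.trans ENNReal.one_lt_top).ne) fun μ hμ => ?_
    set s := energy κ μ μ ^ (1 / 2 : ℝ) with hs
    have hs2 : s ^ 2 = energy κ μ μ := by
      rw [hs, ← ENNReal.rpow_natCast, ← ENNReal.rpow_mul]
      simp
    have h1 : ∀ n, μ (D n) ≤ δ n * s := fun n => by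
      rw [← ENNReal.pow_le_pow_left_iff two_ne_zero, mul_pow, hs2]
      refine (measure_sq_le_innerCap_mul hker (hDo n).measurableSet
        (hDc n).ne_top hμ).trans ?_
      gcongr
      exact (hDc n).le
    rw [← hs2, ← mul_pow]
    gcongr
    calc μ (⋃ n, D n) ≤ ∑' n, μ (D n) := measure_iUnion_le _
      _ ≤ ∑' n, δ n * s := ENNReal.tsum_le_tsum h1
      _ = (∑' n, (δ n : ℝ≥0∞)) * s := ENNReal.tsum_mul_right
      _ ≤ ε * s := by gcongr
  have h2 := (outerCap_le (isOpen_iUnion hDo) (iUnion_mono hED)).trans hcap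
  have h3 : ε ^ 2 ≤ ε := by
    rw [pow_two]
    exact mul_le_of_le_one_right' hε.1.le
  exact (h2.trans h3).not_gt hε.2

section EnergyMap

variable {H : Type*} [NormedAddCommGroup H] [InnerProductSpace ℝ H] {κ : X → X → ℝ≥0∞}
  {Φ : Measure X → H}

theorem outerCap_eq_zero_of_isCompact (hker : IsKernel κ) (hE : EnergyPrinciple κ)
    (hC : Consistent κ) (hA2 : A2 κ) (hΦ : IsEnergyMap κ Φ)
    {K : Set X} (hK : IsCompact K) (h0 : ∀ σ ∈ Eplus κ, σ K = 0) : outerCap κ K = 0 := by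
  by_contra hne
  let := TopologicalSpace.metrizableSpaceMetric X
  obtain ⟨δ, hδ, hL⟩ := hK.exists_isCompact_cthickening
  set r : ℕ → ℝ := fun n => δ / (n + 1) with hr
  have hr0 : ∀ n, 0 < r n := fun n => by positivity
  have hranti : Antitone r := fun n m hnm => by simp only [hr]; gcongr
  have hrδ : ∀ n, r n ≤ δ := fun n => div_le_self hδ.le (by linarith [n.cast_nonneg (α := ℝ)])
  let D : ℕ → Set X := fun n => Metric.thickening (r n) K
  have hDanti : Antitone D := fun n m hnm => Metric.thickening_mono (hranti hnm) K
  have hex : ∀ n, ∃ μ ∈ EplusOn κ (D n), μ univ = 1 ∧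
      energy κ μ μ < (outerCap κ K)⁻¹ + 1 := fun n => by
    have h1 : (⨅ μ ∈ {μ ∈ EplusOn κ (D n) | μ univ = 1}, energy κ μ μ) <
        (outerCap κ K)⁻¹ + 1 := by
      refine lt_of_le_of_lt ?_ (ENNReal.lt_add_right (ENNReal.inv_ne_top.2 hne) one_ne_zero)
      rw [ENNReal.le_inv_iff_le_inv]
      exact outerCap_le Metric.isOpen_thickening (Metric.self_subset_thickening (hr0 n) K)
    simp only [iInf_lt_iff] at h1
    obtain ⟨μ, hμ, hlt⟩ := h1
    exact ⟨μ, hμ.1, hμ.2, hlt⟩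
  obtain ⟨c, hc, hcau, -⟩ := exists_cauchySeq_near_minimal
    (S := fun n => Φ '' {μ ∈ EplusOn κ (D n) | μ univ = 1})
    (fun n m hnm => image_mono fun μ hμ => ⟨EplusOn_mono κ (hDanti hnm) hμ.1, hμ.2⟩) (by
      rintro n _ ⟨σ, hσ, rfl⟩ _ ⟨τ, hτ, rfl⟩
      refine ⟨_, ⟨smul_mem_EplusOn hker _ (add_mem_EplusOn hker hE hσ.1 hτ.1), ?_⟩,
        hΦ.image_midpoint hker hE hσ.1.1 hτ.1.1⟩
      rw [Measure.smul_apply, Measure.add_apply, hσ.2, hτ.2, ENNReal.smul_def, smul_eq_mul,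
        one_add_one_eq_two, ENNReal.coe_div two_ne_zero]
      simp [ENNReal.inv_mul_cancel]) (0 : H) (R := √((outerCap κ K)⁻¹ + 1).toReal) (fun n => by
      obtain ⟨μ, hμ, h1, hen⟩ := hex n
      refine ⟨_, ⟨μ, ⟨hμ, h1⟩, rfl⟩, ?_⟩
      rw [sub_zero]
      refine Real.le_sqrt_of_sq_le ?_
      rw [hΦ.norm_sq hμ.1]
      exact ENNReal.toReal_mono (by simp [hne]) hen.le)
  choose m hm hmc using hc
  obtain ⟨ν, hν, hvague, -⟩ := exists_limit hker hE hC hA2 hΦ (fun n => (hm n).1.1)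
    (by simpa only [hmc] using hcau)
  have hlf := isLocallyFinite_of_mem hν
  have hνK : ν Kᶜ = 0 := by
    have h1 : Kᶜ = ⋃ n, (Metric.cthickening (r n) K)ᶜ := by
      rw [← compl_iInter, compl_inj_iff]
      refine Subset.antisymm (subset_iInter fun n => Metric.self_subset_cthickening K)
        fun x hx => ?_
      rw [mem_iInter] at hx
      rw [← hK.isClosed.closure_eq, Metric.mem_closure_iff_infEDist_zero,
        ← nonpos_iff_eq_zero]
      have hlim : Tendsto (fun n => ENNReal.ofReal (r n)) atTop (𝓝 (ENNReal.ofReal 0)) :=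
        ENNReal.tendsto_ofReal (by
          simpa [hr, div_eq_mul_inv] using
            (tendsto_one_div_add_atTop_nhds_zero_nat (𝕜 := ℝ)).const_mul δ)
      rw [ENNReal.ofReal_zero] at hlim
      exact ge_of_tendsto' hlim fun n => Metric.mem_cthickening_iff.1 (hx n)
    rw [h1, measure_iUnion_null_iff]
    intro n
    refine le_antisymm ?_ bot_le
    refine (measure_open_le_liminf_of_vagueConv (fun n => isLocallyFinite_of_mem (hm n).1.1) hvague
      Metric.isClosed_cthickening.isOpen_compl).trans ?_
    refine (liminf_le_liminf (v := fun _ => (0 : ℝ≥0∞)) ?_).trans_eq (by simp)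
    filter_upwards [eventually_ge_atTop n] with k hk
    refine (measure_mono_null (compl_subset_compl.2 ?_) (mem_EplusOn_iff.1 (hm k).1).2).le
    exact (hDanti hk).trans (Metric.thickening_subset_cthickening _ _)
  have hν0 : ν = 0 := by
    rw [← Measure.measure_univ_eq_zero, ← union_compl_self K]
    exact measure_union_null (h0 ν hν) hνK
  obtain ⟨f, hf1, -, hfc, -⟩ := exists_continuous_one_zero_of_isCompact hL isClosed_empty
    (disjoint_empty _)
  have h2 := hvague f f.continuous hfc
  have h3 : ∀ n, ∫ x, f x ∂(m n) = 1 := fun n => by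
    have : f =ᵐ[m n] fun _ => (1 : ℝ) := by
      have := (mem_EplusOn_iff.1 (hm n).1).2
      filter_upwards [compl_mem_ae_iff.2 this] with x hx
      rw [compl_compl] at hx
      exact hf1 (Metric.thickening_subset_cthickening_of_le (hrδ n) K hx)
    rw [integral_congr_ae this]
    simp [Measure.real, (hm n).2]
  simp only [h3, hν0, integral_zero_measure] at h2
  exact one_ne_zero (tendsto_nhds_unique tendsto_const_nhds h2)

theorem outerCap_eq_zero_of_isSigmaCompact (hker : IsKernel κ) (hE : EnergyPrinciple κ)
    (hC : Consistent κ) (hA2 : A2 κ) (hΦ : IsEnergyMap κ Φ)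
    {E : Set X} (hE' : IsSigmaCompact E) (h0 : ∀ σ ∈ Eplus κ, σ E = 0) : outerCap κ E = 0 := by
  obtain ⟨K, hK, rfl⟩ := hE'
  exact outerCap_iUnion_eq_zero hker fun n => outerCap_eq_zero_of_isCompact hker hE hC hA2 hΦ (hK n)
    fun σ hσ => measure_mono_null (subset_iUnion K n) (h0 σ hσ)

theorem OuterLam_eq_InnerLam (hker : IsKernel κ) (hE : EnergyPrinciple κ)
    (hC : Consistent κ) (hA2 : A2 κ) (hΦ : IsEnergyMap κ Φ)
    {B : Set X} (hB : IsSigmaCompact B) (μ : Measure X) :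
    OuterLam κ B μ = InnerLam κ B μ := by
  refine Subset.antisymm (OuterLam_subset_InnerLam κ B μ) fun ν hν => ⟨hν.1, ?_⟩
  have hsc : IsSigmaCompact {x | x ∈ B ∧ ¬ pot κ μ x ≤ pot κ ν x} := by
    simp_rw [not_le]
    exact isSigmaCompact_inter hB (isSigmaCompact_setOf_lt (lowerSemicontinuous_pot hker ν)
      (lowerSemicontinuous_pot hker μ))
  refine outerCap_eq_zero_of_isSigmaCompact hker hE hC hA2 hΦ hsc fun σ hσ => ?_
  rw [← Measure.restrict_eq_zero]
  exact (innerCap_eq_zero_iff hker).1 hν.2 _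
    (restrict_mem_EplusOn_self hσ (measurableSet_of_isSigmaCompact hsc))

end EnergyMap

theorem exists_countable_closed_under {α : Type*} (f : α → α → α) {S : Set α} (hS : S.Countable) :
    ∃ T : Set α, T.Countable ∧ S ⊆ T ∧ ∀ x ∈ T, ∀ y ∈ T, f x y ∈ T := by
  let D : ℕ → Set α := fun n => Nat.rec S (fun _ E => E ∪ image2 f E E) n
  have hD : ∀ n, (D n).Countable := fun n => by
    induction n with
    | zero => exact hS
    | succ n ih => exact ih.union (ih.image2 ih f)
  have hmono : Monotone D := monotone_nat_of_le_succ fun n => subset_union_left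
  refine ⟨⋃ n, D n, countable_iUnion hD, subset_iUnion D 0, fun x hx y hy => ?_⟩
  obtain ⟨n, hn⟩ := mem_iUnion.1 hx
  obtain ⟨k, hk⟩ := mem_iUnion.1 hy
  refine mem_iUnion.2 ⟨max n k + 1, Or.inr ⟨x, ?_, y, ?_, rfl⟩⟩
  · exact hmono (le_max_left n k) hn
  · exact hmono (le_max_right n k) hk

theorem exists_countable_determining (X : Type*) [TopologicalSpace X] [T2Space X]
    [LocallyCompactSpace X] [MeasurableSpace X] [BorelSpace X] [SecondCountableTopology X] :
    ∃ f : ℕ → X → ℝ, (∀ k, Continuous (f k)) ∧ (∀ k, HasCompactSupport (f k)) ∧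
      ∀ μ ν : Measure X, IsLocallyFiniteMeasure μ → IsLocallyFiniteMeasure ν →
        (∀ k, ∫ x, f k x ∂μ = ∫ x, f k x ∂ν) → μ = ν := by
  let L : CompactExhaustion X := default
  have hex : ∀ n, ∃ χ : C(X, ℝ), EqOn χ 1 (L n) ∧ HasCompactSupport χ := fun n => by
    obtain ⟨χ, h1, -, h2, -⟩ := exists_continuous_one_zero_of_isCompact (L.isCompact n)
      isClosed_empty (disjoint_empty _)
    exact ⟨χ, h1, h2⟩
  choose χ hχ1 hχc using hex
  let g := TopologicalSpace.denseSeq C(X, ℝ)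
  refine ⟨fun k x => χ k.unpair.1 x * g k.unpair.2 x, fun k => by fun_prop,
    fun k => (hχc _).mul_right, fun μ ν hμ hν h => ?_⟩
  have hall : ∀ (n : ℕ) (φ : C(X, ℝ)), ∫ x, χ n x * φ x ∂μ = ∫ x, χ n x * φ x ∂ν := by
    intro n φ
    have hcont : ∀ σ : Measure X, IsLocallyFiniteMeasure σ →
        Continuous fun φ : C(X, ℝ) => ∫ x, χ n x * φ x ∂σ := fun σ _ => by
      rw [← continuousOn_univ]
      refine continuousOn_integral_of_compact_support (hχc n).isCompact
        (Continuous.continuousOn ?_) fun φ x _ hx => ?_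
      · simp only [Function.uncurry_def]
        fun_prop
      · rw [image_eq_zero_of_notMem_tsupport hx, zero_mul]
    refine congrFun ((TopologicalSpace.denseRange_denseSeq C(X, ℝ)).equalizer
      (hcont μ hμ) (hcont ν hν) (funext fun k => ?_)) φ
    simpa using h (Nat.pair n k)
  refine Measure.ext_of_integral_eq_on_compactlySupported fun f => ?_
  obtain ⟨n, hn⟩ := L.exists_superset_of_isCompact f.hasCompactSupport
  have heq : ∀ x, χ n x * f.toContinuousMap x = f x := fun x => by
    by_cases hx : x ∈ tsupport f
    · rw [hχ1 n (hn hx), Pi.one_apply, one_mul]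
      rfl
    · have : f x = 0 := image_eq_zero_of_notMem_tsupport hx
      rw [this]
      exact mul_eq_zero_of_right _ this
  simpa only [heq] using hall n f.toContinuousMap

theorem exists_countable_dense_EplusOn {H : Type*} [NormedAddCommGroup H] [InnerProductSpace ℝ H]
    {κ : X → X → ℝ≥0∞} {Φ : Measure X → H} (hker : IsKernel κ) (hE : EnergyPrinciple κ)
    (hC : Consistent κ) (hA2 : A2 κ) (hΦ : IsEnergyMap κ Φ) (A : Set X) :
    ∃ d : ℕ → Measure X, (∀ p, d p ∈ EplusOn κ A) ∧
      ∀ σ ∈ EplusOn κ A, ∀ ε : ℝ, 0 < ε → ∃ p, strDist κ σ (d p) < ε := by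
  obtain ⟨f, hfcont, hfcs, hf⟩ := exists_countable_determining X
  let T : EplusOn κ A → (ℕ → ℝ) × ℝ := fun τ =>
    (fun k => ∫ x, f k x ∂(τ : Measure X), (energy κ (τ : Measure X) τ).toReal)
  let _ : TopologicalSpace (EplusOn κ A) := TopologicalSpace.induced T inferInstance
  have hTc : Continuous T := continuous_induced_dom
  have : SecondCountableTopology (EplusOn κ A) :=
    TopologicalSpace.secondCountableTopology_induced _ _ T
  obtain ⟨D₀, hD₀c, hD₀⟩ := TopologicalSpace.exists_countable_dense (EplusOn κ A)
  obtain ⟨D₁, hD₁c, hD₁, hD₁m⟩ := exists_countable_closed_under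
    (fun σ τ : Measure X => (1 / 2 : ℝ≥0) • (σ + τ)) (hD₀c.image Subtype.val)
  set D := D₁ ∩ EplusOn κ A with hDdef
  have hDmid : ∀ σ ∈ D, ∀ τ ∈ D, (1 / 2 : ℝ≥0) • (σ + τ) ∈ D := fun σ hσ τ hτ =>
    ⟨hD₁m σ hσ.1 τ hτ.1, smul_mem_EplusOn hker _ (add_mem_EplusOn hker hE hσ.2 hτ.2)⟩
  have hD₀D : ∀ τ ∈ D₀, (τ : Measure X) ∈ D := fun τ hτ => ⟨hD₁ ⟨τ, hτ, rfl⟩, τ.2⟩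
  have hDne : D.Nonempty := by
    have : Nonempty (EplusOn κ A) := ⟨⟨0, zero_mem_EplusOn κ A⟩⟩
    obtain ⟨τ, hτ⟩ := hD₀.nonempty
    exact ⟨τ, hD₀D τ hτ⟩
  obtain ⟨d, hd⟩ := (hD₁c.mono inter_subset_left : D.Countable).exists_eq_range hDne
  refine ⟨d, fun p => (hd ▸ mem_range_self p : d p ∈ D).2, fun σ hσ ε hε => ?_⟩
  let C : ℕ → Set (Measure X) := fun n =>
    {τ ∈ D | ∀ k ≤ n, |∫ x, f k x ∂τ - ∫ x, f k x ∂σ| ≤ 1 / ((n : ℝ) + 1)}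
  have hCanti : Antitone C := fun n m hnm τ hτ => ⟨hτ.1, fun k hk =>
    (hτ.2 k (hk.trans hnm)).trans (by gcongr)⟩
  have hintegral : ∀ τ ∈ Eplus κ, ∀ k, Integrable (f k) τ := fun τ hτ k =>
    have := isLocallyFinite_of_mem hτ
    (hfcont k).integrable_of_hasCompactSupport (hfcs k)
  obtain ⟨c, hc, hcau, -⟩ := exists_cauchySeq_near_minimal (S := fun n => Φ '' C n)
    (fun n m hnm => image_mono (hCanti hnm)) (by
      rintro n _ ⟨τ, hτ, rfl⟩ _ ⟨τ', hτ', rfl⟩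
      refine ⟨_, ⟨hDmid τ hτ.1 τ' hτ'.1, fun k hk => ?_⟩,
        hΦ.image_midpoint hker hE hτ.1.2.1 hτ'.1.2.1⟩
      rw [integral_smul_nnreal_measure, integral_add_measure (hintegral τ hτ.1.2.1 k)
        (hintegral τ' hτ'.1.2.1 k), NNReal.smul_def, smul_eq_mul]
      have h1 := abs_le.1 (hτ.2 k hk)
      have h2 := abs_le.1 (hτ'.2 k hk)
      rw [abs_le]
      push_cast
      constructor <;> linarith [h1.1, h1.2, h2.1, h2.2]) (0 : H)
    (R := √((energy κ σ σ).toReal + 1)) (fun n => by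
      have h1 : ∀ᶠ τ in 𝓝 (⟨σ, hσ⟩ : EplusOn κ A), (T τ).2 < (energy κ σ σ).toReal + 1 :=
        (hTc.snd.tendsto _).eventually_lt_const (lt_add_one _)
      have h2 : ∀ᶠ τ in 𝓝 (⟨σ, hσ⟩ : EplusOn κ A), ∀ k ≤ n,
          |(T τ).1 k - ∫ x, f k x ∂σ| < 1 / ((n : ℝ) + 1) := by
        refine (eventually_all_finite (finite_Iic n)).2 fun k _ => ?_
        have h3 : Continuous fun τ => |(T τ).1 k - ∫ x, f k x ∂σ| := by fun_prop
        refine (h3.tendsto _).eventually_lt_const ?_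
        simp only [T, sub_self, abs_zero]
        positivity
      obtain ⟨τ, hτD, hτ1, hτ2⟩ :=
        ((mem_closure_iff_frequently.1 (hD₀ ⟨σ, hσ⟩)).and_eventually (h1.and h2)).exists
      refine ⟨_, ⟨τ, ⟨hD₀D τ hτD, fun k hk => (hτ2 k hk).le⟩, rfl⟩, ?_⟩
      rw [sub_zero]
      refine Real.le_sqrt_of_sq_le ?_
      rw [hΦ.norm_sq τ.2.1]
      exact hτ1.le)
  choose m hm hmc using hc
  obtain ⟨ν, hν, hvague, hlim⟩ := exists_limit hker hE hC hA2 hΦ (fun n => (hm n).1.2.1)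
    (by simpa only [hmc] using hcau)
  have hνσ : ν = σ := by
    refine hf ν σ (isLocallyFinite_of_mem hν) (isLocallyFinite_of_mem hσ.1) fun k => ?_
    refine tendsto_nhds_unique (hvague (f k) (hfcont k) (hfcs k)) ?_
    rw [tendsto_iff_norm_sub_tendsto_zero]
    refine squeeze_zero' (Eventually.of_forall fun _ => norm_nonneg _) ?_
      (tendsto_one_div_add_atTop_nhds_zero_nat (𝕜 := ℝ))
    filter_upwards [eventually_ge_atTop k] with n hn
    exact (hm n).2 k hn
  subst hνσ
  obtain ⟨n, hn⟩ := (Metric.tendsto_nhds.1 hlim ε hε).exists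
  obtain ⟨p, hp⟩ : m n ∈ range d := hd ▸ (hm n).1
  refine ⟨p, ?_⟩
  rwa [hp, hΦ.strDist_eq hν (hm n).1.2.1, ← dist_eq_norm, dist_comm]

theorem exists_isSigmaCompact_subset {μ : Measure X} [μ.InnerRegular] [IsLocallyFiniteMeasure μ]
    {S : Set X} (hS : NullMeasurableSet S μ) : ∃ T ⊆ S, IsSigmaCompact T ∧ μ (S \ T) = 0 := by
  obtain ⟨M, hMS, hM, hMae⟩ := hS.exists_measurable_subset_ae_eq
  have hex : ∀ n k : ℕ, ∃ K ⊆ M ∩ compactCovering X n, IsCompact K ∧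
      μ ((M ∩ compactCovering X n) \ K) < ((k : ℝ≥0∞) + 1)⁻¹ := fun n k => by
    have hc := isCompact_compactCovering X n
    exact (hM.inter hc.measurableSet).exists_isCompact_sdiff_lt
      (measure_ne_top_of_subset inter_subset_right hc.measure_lt_top.ne) (by simp)
  choose K hKs hK hlt using hex
  refine ⟨⋃ n, ⋃ k, K n k, iUnion₂_subset fun n k => (hKs n k).trans (inter_subset_left.trans hMS),
    isSigmaCompact_iUnion _ fun n => isSigmaCompact_iUnion_of_isCompact _ (hK n), ?_⟩
  have h1 : ∀ n, μ ((M ∩ compactCovering X n) \ ⋃ k, K n k) = 0 := fun n => by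
    have hlim : Tendsto (fun k : ℕ => ((k : ℝ≥0∞) + 1)⁻¹) atTop (𝓝 0) := by
      have := ENNReal.tendsto_inv_nat_nhds_zero.comp (tendsto_add_atTop_nat 1)
      simpa [Function.comp_def] using this
    exact le_antisymm (ge_of_tendsto' hlim fun k => (measure_mono
      (sdiff_subset_sdiff_right (subset_iUnion (K n) k))).trans (hlt n k).le) bot_le
  refine measure_mono_null (t := (S \ M) ∪ ⋃ n, (M ∩ compactCovering X n) \ ⋃ k, K n k) ?_
    (measure_union_null (ae_le_set.1 hMae.symm.le) (measure_iUnion_null h1))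
  rintro x ⟨hxS, hx⟩
  by_cases hxM : x ∈ M
  · obtain ⟨n, hn⟩ := mem_iUnion.1 ((iUnion_compactCovering X).symm ▸ mem_univ x)
    exact Or.inr (mem_iUnion.2 ⟨n, ⟨hxM, hn⟩, fun h => hx (mem_iUnion.2 ⟨n, h⟩)⟩)
  · exact Or.inl ⟨hxS, hxM⟩

theorem eq_of_pot_le_of_pot_le {κ : X → X → ℝ≥0∞} (hker : IsKernel κ) (hE : EnergyPrinciple κ)
    {μ ν : Measure X} (hμ : μ ∈ Eplus κ) (hν : ν ∈ Eplus κ) (h1 : ∀ x, pot κ μ x ≤ pot κ ν x)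
    (h2 : ∀ x, pot κ ν x ≤ pot κ μ x) : μ = ν := by
  have h : pot κ μ = pot κ ν := funext fun x => le_antisymm (h1 x) (h2 x)
  refine (hE μ hμ ν hν).2 ?_
  have h3 : energy κ μ μ = energy κ μ ν := by rw [energy, energy, h]
  have h4 : energy κ ν ν = energy κ ν μ := by rw [energy, energy, h]
  rw [h3, h4, energy_comm_of_mem hker hν hμ, two_mul]

section EnergyMap

variable {H : Type*} [NormedAddCommGroup H] [InnerProductSpace ℝ H] {κ : X → X → ℝ≥0∞}
  {Φ : Measure X → H}

theorem exists_outerCap_eq_zero_tendsto_pot (hker : IsKernel κ) (hE : EnergyPrinciple κ)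
    (hC : Consistent κ) (hA2 : A2 κ) (hΦ : IsEnergyMap κ Φ) {b : ℕ → Measure X} {ν : Measure X}
    (hb : ∀ n, b n ∈ Eplus κ) (hν : ν ∈ Eplus κ) (hmono : ∀ x, Monotone fun n => pot κ (b n) x)
    (hle : ∀ n x, pot κ (b n) x ≤ pot κ ν x)
    (hlim : Tendsto (fun n => Φ (b n)) atTop (𝓝 (Φ ν))) :
    ∃ E : Set X, outerCap κ E = 0 ∧
      ∀ x ∉ E, Tendsto (fun n => pot κ (b n) x) atTop (𝓝 (pot κ ν x)) := by
  have hlsc : LowerSemicontinuous fun x => ⨆ n, pot κ (b n) x :=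
    lowerSemicontinuous_iSup fun n => lowerSemicontinuous_pot hker (b n)
  refine ⟨{x | ⨆ n, pot κ (b n) x < pot κ ν x},
    outerCap_eq_zero_of_isSigmaCompact hker hE hC hA2 hΦ
      (isSigmaCompact_setOf_lt hlsc (lowerSemicontinuous_pot hker ν)) fun σ hσ => ?_,
    fun x hx => ?_⟩
  · have h1 : Tendsto (fun n => energy κ σ (b n)) atTop (𝓝 (∫⁻ x, ⨆ n, pot κ (b n) x ∂σ)) := by
      rw [lintegral_iSup (fun n => measurable_pot hker (b n)) fun n m hnm x => hmono x hnm]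
      exact tendsto_atTop_iSup fun n m hnm => lintegral_mono fun x => hmono x hnm
    have h2 : Tendsto (fun n => energy κ σ (b n)) atTop (𝓝 (energy κ σ ν)) := by
      rw [← ENNReal.tendsto_toReal_iff (fun n => energy_ne_top hE hσ (hb n))
        (energy_ne_top hE hσ hν), ← hΦ _ hσ _ hν]
      simp_rw [← hΦ _ hσ _ (hb _)]
      exact tendsto_const_nhds.inner hlim
    have h3 := tendsto_nhds_unique h1 h2
    have h4 : (fun x => ⨆ n, pot κ (b n) x) =ᵐ[σ] pot κ ν :=
      ae_eq_of_ae_le_of_lintegral_le (Eventually.of_forall fun x => iSup_le fun n => hle n x)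
        (h3 ▸ energy_ne_top hE hσ hν) (measurable_pot hker ν).aemeasurable h3.ge
    exact measure_mono_null (fun x hx => ne_of_lt hx) (ae_iff.1 h4)
  · have h : ⨆ n, pot κ (b n) x = pot κ ν x :=
      le_antisymm (iSup_le fun n => hle n x) (not_lt.1 hx)
    rw [← h]
    exact tendsto_atTop_iSup (hmono x)

theorem exists_isSigmaCompact_exhaustion (hker : IsKernel κ) (hE : EnergyPrinciple κ)
    (hC : Consistent κ) (hA2 : A2 κ) (hΦ : IsEnergyMap κ Φ) (A : Set X) {U : ℕ → Set X}
    (hU : ∀ j, MeasurableSet (U j)) (hUmono : Monotone U) (hUuniv : ⋃ j, U j = univ) :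
    ∃ B : ℕ → Set X, (∀ j, IsSigmaCompact (B j)) ∧ (∀ j, B j ⊆ A ∩ U j) ∧ Monotone B ∧
      ∀ σ ∈ EplusOn κ A, ∀ ε : ℝ, 0 < ε →
        ∃ n, ∃ τ ∈ EplusOn κ (B n), strDist κ σ τ < ε := by
  obtain ⟨d, hd, hdense⟩ := exists_countable_dense_EplusOn hker hE hC hA2 hΦ A
  have hex : ∀ p i, ∃ T ⊆ A ∩ U i, IsSigmaCompact T ∧ d p ((A ∩ U i) \ T) = 0 := fun p i => by
    have := (hd p).1.1.1
    have := isLocallyFinite_of_mem (hd p).1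
    exact exists_isSigmaCompact_subset ((hd p).2.1.inter (hU i).nullMeasurableSet)
  choose T hTs hT hT0 using hex
  have hmono : Monotone fun j => ⋃ i ≤ j, ⋃ p, T p i := fun j k hjk =>
    biUnion_subset_biUnion_left fun i hi => le_trans hi hjk
  have hsc : ∀ j : ℕ, IsSigmaCompact (⋃ i ≤ j, ⋃ p, T p i) := fun j =>
    isSigmaCompact_biUnion (to_countable (Iic j)) fun i _ =>
      isSigmaCompact_iUnion _ fun p => hT p i
  refine ⟨fun j => ⋃ i ≤ j, ⋃ p, T p i, hsc, fun j => ?_, hmono, fun σ hσ ε hε => ?_⟩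
  · exact iUnion₂_subset fun i hi => iUnion_subset fun p =>
      (hTs p i).trans (inter_subset_inter_right A (hUmono hi))
  · obtain ⟨p, hp⟩ := hdense σ hσ (ε / 2) (half_pos hε)
    have h0 : d p (⋃ j, ⋃ i ≤ j, ⋃ p, T p i)ᶜ = 0 := by
      refine measure_mono_null (t := Aᶜ ∪ ⋃ i, (A ∩ U i) \ T p i) (fun x hx => ?_)
        (measure_union_null (mem_EplusOn_iff.1 (hd p)).2 (measure_iUnion_null (hT0 p)))
      by_cases hxA : x ∈ A
      · obtain ⟨i, hi⟩ := mem_iUnion.1 (hUuniv.symm ▸ mem_univ x)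
        exact Or.inr (mem_iUnion.2 ⟨i, ⟨hxA, hi⟩, fun h => hx
          (mem_iUnion.2 ⟨i, mem_iUnion₂.2 ⟨i, le_rfl, mem_iUnion.2 ⟨p, h⟩⟩⟩)⟩)
      · exact Or.inl hxA
    obtain ⟨n, hn⟩ := exists_strDist_restrict_lt hker hE (hd p).1 hmono h0 (half_pos hε)
    have hr := restrict_mem_EplusOn_self (hd p).1 (measurableSet_of_isSigmaCompact (hsc n))
    refine ⟨n, _, hr, ?_⟩
    rw [hΦ.strDist_eq hσ.1 (hd p).1] at hp
    rw [hΦ.strDist_eq (hd p).1 hr.1] at hn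
    rw [hΦ.strDist_eq hσ.1 hr.1]
    linarith [norm_sub_le_norm_sub_add_norm_sub (Φ σ) (Φ (d p))
      (Φ ((d p).restrict (⋃ i ≤ n, ⋃ p, T p i)))]

end EnergyMap

end Aux

/-- Convergence of outer balayages to Borel sets `B_j ⊆ A_j = A ∩ U_j`. -/
theorem statement16 [SecondCountableTopology X] (κ : X → X → ℝ≥0∞) (hker : IsKernel κ)
    (hE : EnergyPrinciple κ) (hC : Consistent κ) (hD : Domination κ) (hA2 : A2 κ)
    (A : Set X) (U : ℕ → Set X) (hUmeas : ∀ j, MeasurableSet (U j))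
    (hUmono : Monotone U) (hUuniv : (⋃ j, U j) = Set.univ) :
    ∃ B : ℕ → Set X,
      (∀ j, MeasurableSet (B j)) ∧ (∀ j, B j ⊆ A ∩ U j) ∧ (∀ j, B j ⊆ B (j + 1)) ∧
      ∀ μ ∈ Eplus κ, ∀ bA : Measure X, IsInnerBal κ A μ bA →
        ∃ ob : ℕ → Measure X, (∀ j, IsOuterBal κ (B j) μ (ob j)) ∧
          Tendsto (fun j => strDist κ (ob j) bA) atTop (nhds (0 : ℝ)) ∧
          VagueConv atTop ob bA ∧
          ∃ E : Set X, outerCap κ E = 0 ∧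
            ∀ x ∉ E, Tendsto (fun j => pot κ (ob j) x) atTop (nhds (pot κ bA x)) := by
  obtain ⟨H, _, _, Φ, hΦ⟩ := exists_energy_map hker hE
  have hΦ : IsEnergyMap κ Φ := hΦ
  obtain ⟨B, hsc, hBs, hmono, hdense⟩ :=
    exists_isSigmaCompact_exhaustion hker hE hC hA2 hΦ A hUmeas hUmono hUuniv
  refine ⟨B, fun j => measurableSet_of_isSigmaCompact (hsc j), hBs,
    fun j => hmono j.le_succ, fun μ hμ bA hbA => ?_⟩
  have hBA : ∀ n, B n ⊆ A := fun n => (hBs n).trans inter_subset_left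
  choose b hb using fun n => exists_isProj_of_isSigmaCompact hker hE hC hD hA2 hΦ (hsc n) hμ
  obtain ⟨ν, hν, hvague, hlim⟩ :=
    exists_isProj_of_dense hker hE hC hA2 hΦ hmono hBA hdense hμ hb
  obtain rfl : ν = bA := eq_of_pot_le_of_pot_le hker hE hν.mem hbA.1.1 (hν.min bA hbA.1)
    (hbA.2 ν (hν.mem_InnerLam hker))
  refine ⟨b, fun j => ?_, ?_, hvague, exists_outerCap_eq_zero_tendsto_pot hker hE hC hA2 hΦ
    (fun n => (hb n).mem) hν.mem (fun x => monotone_nat_of_le_succ fun n => ?_)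
    (fun n => (hb n).min ν (InnerLam_anti hker (hBA n) μ (hν.mem_InnerLam hker))) hlim⟩
  · rw [IsOuterBal, OuterLam_eq_InnerLam hker hE hC hA2 hΦ (hsc j)]
    exact ⟨(hb j).mem_InnerLam hker, (hb j).min⟩
  · simp_rw [hΦ.strDist_eq (hb _).mem hν.mem]
    exact tendsto_iff_norm_sub_tendsto_zero.1 hlim
  · exact (hb n).min _
      (InnerLam_anti hker (hmono n.le_succ) μ ((hb (n + 1)).mem_InnerLam hker)) x

end Balayage
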